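/- arXiv:2507.03880 — 11 statements merged into one kernel-verified Lean document; each statement's English description precedes it below -/
import Mathlib

section
/- Let n ≥ 1, let c_{jk} (1 ≤ j < k ≤ n) be real constants, and let u^{(1)},…,u^{(n)} : ℝ² → ℝ be smooth functions of (x,t) solving the MCmSP equation. Then the conservation-law identity ∂_t(1 + S) = ∂_x( F·(1 + S) ) holds, where S = Σ_{1≤j<k≤n} c_{jk} ∂_x u^{(j)} ∂_x u^{(k)} and F = Σ_{1≤j<k≤n} c_{jk} u^{(j)} u^{(k)}; equivalently, with ρ = (1+S)^{-1}, one has ∂_t(1/ρ) − ∂_x(F/ρ) = 0. -/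
/-- Partial derivative with respect to the first variable. -/
noncomputable def pdx (f : ℝ → ℝ → ℝ) (x t : ℝ) : ℝ := deriv (fun y => f y t) x

/-- Partial derivative with respect to the second variable. -/
noncomputable def pdt (f : ℝ → ℝ → ℝ) (x t : ℝ) : ℝ := deriv (fun s => f x s) t

/-- S = Σ_{1≤j<k≤n} c_{jk} ∂_x u^{(j)} ∂_x u^{(k)}. -/
noncomputable def Sfun {n : ℕ} (c : Fin n → Fin n → ℝ) (u : Fin n → ℝ → ℝ → ℝ)
    (x t : ℝ) : ℝ :=
  ∑ j : Fin n, ∑ k : Fin n,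
    if j < k then c j k * pdx (u j) x t * pdx (u k) x t else 0

/-- F = Σ_{1≤j<k≤n} c_{jk} u^{(j)} u^{(k)}. -/
noncomputable def Ffun {n : ℕ} (c : Fin n → Fin n → ℝ) (u : Fin n → ℝ → ℝ → ℝ)
    (x t : ℝ) : ℝ :=
  ∑ j : Fin n, ∑ k : Fin n,
    if j < k then c j k * u j x t * u k x t else 0

/-- A function of two variables is smooth when its uncurried form is. -/
def Smooth₂ (f : ℝ → ℝ → ℝ) : Prop := ContDiff ℝ (⊤ : ℕ∞) (fun p : ℝ × ℝ => f p.1 p.2)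

namespace Smooth₂

variable {f : ℝ → ℝ → ℝ}

theorem hasDerivAt_fst (hf : Smooth₂ f) (x t : ℝ) :
    HasDerivAt (fun y => f y t) (fderiv ℝ (fun p : ℝ × ℝ => f p.1 p.2) (x, t) (1, 0)) x :=
  HasFDerivAt.comp_hasDerivAt (f := fun y : ℝ => (y, t)) x
    ((hf.differentiable (by simp)) (x, t)).hasFDerivAt
    ((hasDerivAt_id x).prodMk (hasDerivAt_const x t))

theorem hasDerivAt_snd (hf : Smooth₂ f) (x t : ℝ) :
    HasDerivAt (fun s => f x s) (fderiv ℝ (fun p : ℝ × ℝ => f p.1 p.2) (x, t) (0, 1)) t :=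
  HasFDerivAt.comp_hasDerivAt (f := fun s : ℝ => (x, s)) t
    ((hf.differentiable (by simp)) (x, t)).hasFDerivAt
    ((hasDerivAt_const t x).prodMk (hasDerivAt_id t))

theorem pdx_eq (hf : Smooth₂ f) (x t : ℝ) :
    pdx f x t = fderiv ℝ (fun p : ℝ × ℝ => f p.1 p.2) (x, t) (1, 0) :=
  (hf.hasDerivAt_fst x t).deriv

theorem pdt_eq (hf : Smooth₂ f) (x t : ℝ) :
    pdt f x t = fderiv ℝ (fun p : ℝ × ℝ => f p.1 p.2) (x, t) (0, 1) :=
  (hf.hasDerivAt_snd x t).deriv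

theorem hasDerivAt_pdx (hf : Smooth₂ f) (x t : ℝ) :
    HasDerivAt (fun y => f y t) (pdx f x t) x :=
  (hf.hasDerivAt_fst x t).differentiableAt.hasDerivAt

theorem hasDerivAt_pdt (hf : Smooth₂ f) (x t : ℝ) :
    HasDerivAt (fun s => f x s) (pdt f x t) t :=
  (hf.hasDerivAt_snd x t).differentiableAt.hasDerivAt

theorem contDiff_fderiv (hf : Smooth₂ f) :
    ContDiff ℝ (⊤ : ℕ∞) (fderiv ℝ (fun p : ℝ × ℝ => f p.1 p.2)) :=
  ContDiff.fderiv_right hf (by simp)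

theorem smooth_pdx (hf : Smooth₂ f) : Smooth₂ (pdx f) := by
  unfold Smooth₂
  simp only [hf.pdx_eq]
  exact hf.contDiff_fderiv.clm_apply contDiff_const

theorem smooth_pdt (hf : Smooth₂ f) : Smooth₂ (pdt f) := by
  unfold Smooth₂
  simp only [hf.pdt_eq]
  exact hf.contDiff_fderiv.clm_apply contDiff_const

/-- Partial derivatives of a smooth function commute. -/
theorem pdt_pdx_comm (hf : Smooth₂ f) (x t : ℝ) :
    pdt (pdx f) x t = pdx (pdt f) x t := by
  have hd : DifferentiableAt ℝ (fderiv ℝ (fun p : ℝ × ℝ => f p.1 p.2)) (x, t) :=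
    hf.contDiff_fderiv.differentiable (by simp) _
  rw [hf.smooth_pdx.pdt_eq, hf.smooth_pdt.pdx_eq]
  simp only [hf.pdx_eq, hf.pdt_eq]
  rw [fderiv_clm_apply hd (by fun_prop), fderiv_clm_apply hd (by fun_prop)]
  simpa using (ContDiffAt.isSymmSndFDerivAt (n := (⊤ : ℕ∞)) hf.contDiffAt
    (by simpa using WithTop.coe_le_coe.2 (le_top : (2 : ℕ∞) ≤ ⊤))).eq (0, 1) (1, 0)

end Smooth₂

/-- The product rule for the quadratic form `Σ_{j<k} c j k * f j * f k`. -/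
theorem HasDerivAt.sum_lt_mul {n : ℕ} (c : Fin n → Fin n → ℝ) {f : Fin n → ℝ → ℝ}
    {f' : Fin n → ℝ} {x : ℝ} (hf : ∀ i, HasDerivAt (f i) (f' i) x) :
    HasDerivAt (fun y => ∑ j : Fin n, ∑ k : Fin n, if j < k then c j k * f j y * f k y else 0)
      (∑ j : Fin n, ∑ k : Fin n,
        if j < k then c j k * (f' j * f k x + f j x * f' k) else 0) x := by
  refine HasDerivAt.fun_sum fun j _ => HasDerivAt.fun_sum fun k _ => ?_
  split_ifs
  · exact (((hf j).const_mul (c j k)).mul (hf k)).congr_deriv (by ring)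
  · exact hasDerivAt_const x 0

/-- smooth solutions of the MCmSP equation satisfy the conservation law
    ∂_t(1 + S) = ∂_x(F·(1 + S)). -/
theorem mcmsp_conservation_law (n : ℕ) (hn : 1 ≤ n) (c : Fin n → Fin n → ℝ)
    (u : Fin n → ℝ → ℝ → ℝ)
    (hu : ∀ i, ContDiff ℝ (⊤ : ℕ∞) (fun p : ℝ × ℝ => u i p.1 p.2))
    (hmcmsp : ∀ i x t,
      pdx (pdt (u i)) x t
        = u i x t
          + pdx (fun x' t' => Ffun c u x' t' * pdx (u i) x' t') x t
          - Sfun c u x t * u i x t) :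
    ∀ x t,
      pdt (fun x' t' => 1 + Sfun c u x' t') x t
        = pdx (fun x' t' => Ffun c u x' t' * (1 + Sfun c u x' t')) x t := by
  intro x t
  have hs : ∀ i, Smooth₂ (u i) := hu
  have hF := HasDerivAt.sum_lt_mul c fun i => (hs i).hasDerivAt_pdx x t
  have hSx := HasDerivAt.sum_lt_mul c fun i => (hs i).smooth_pdx.hasDerivAt_pdx x t
  have hSt := HasDerivAt.sum_lt_mul c fun i => (hs i).smooth_pdx.hasDerivAt_pdt x t
  change HasDerivAt (fun y => Ffun c u y t) _ x at hF
  change HasDerivAt (fun y => Sfun c u y t) _ x at hSx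
  change HasDerivAt (fun s => Sfun c u x s) _ t at hSt
  set F' := ∑ j : Fin n, ∑ k : Fin n,
    if j < k then c j k * (pdx (u j) x t * u k x t + u j x t * pdx (u k) x t) else 0
  set S' := ∑ j : Fin n, ∑ k : Fin n,
    if j < k then c j k * (pdx (pdx (u j)) x t * pdx (u k) x t
      + pdx (u j) x t * pdx (pdx (u k)) x t) else 0 with hS'
  have hut : ∀ i, pdt (pdx (u i)) x t = u i x t
      + (F' * pdx (u i) x t + Ffun c u x t * pdx (pdx (u i)) x t) - Sfun c u x t * u i x t := by
    intro i
    rw [(hs i).pdt_pdx_comm, hmcmsp]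
    congr 2
    exact (hF.mul ((hs i).smooth_pdx.hasDerivAt_pdx x t)).deriv
  have hL : pdt (fun x' t' => 1 + Sfun c u x' t') x t = _ := (hSt.const_add 1).deriv
  have hR : pdx (fun x' t' => Ffun c u x' t' * (1 + Sfun c u x' t')) x t = _ :=
    (hF.mul (hSx.const_add 1)).deriv
  have key : (∑ j : Fin n, ∑ k : Fin n, if j < k then c j k *
      (pdt (pdx (u j)) x t * pdx (u k) x t + pdx (u j) x t * pdt (pdx (u k)) x t) else 0)
      = (1 - Sfun c u x t) * F' + 2 * F' * Sfun c u x t + Ffun c u x t * S' := by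
    simp only [hut]
    generalize Ffun c u x t = F
    have hS : 2 * F' * Sfun c u x t = 2 * F' * ∑ j : Fin n, ∑ k : Fin n,
      if j < k then c j k * pdx (u j) x t * pdx (u k) x t else 0 := rfl
    rw [hS]
    generalize Sfun c u x t = S
    have hF'' : (1 - S) * F' = (1 - S) * ∑ j : Fin n, ∑ k : Fin n,
      if j < k then c j k * (pdx (u j) x t * u k x t + u j x t * pdx (u k) x t) else 0 := rfl
    rw [hF'', hS']
    clear_value F'
    simp only [Finset.mul_sum, ← Finset.sum_add_distrib]
    refine Finset.sum_congr rfl fun j _ => Finset.sum_congr rfl fun k _ => ?_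
    split_ifs <;> ring
  rw [hL, hR, key]
  ring
end

section
/- Let n ≥ 1, let c_{jk} (1 ≤ j < k ≤ n) be real constants, and let u^{(1)},…,u^{(n)} : ℝ² → ℝ be smooth functions of (x,t) solving the MCSP equation, and assume 1 + S(x,t) > 0 for all (x,t). Then ∂_t( √(1+S) ) = ∂_x( (F/2)·√(1+S) ); equivalently, with ρ = (1+S)^{-1/2}, one has ∂_t(1/ρ) − ∂_x( F/(2ρ) ) = 0. -/
/-- A function of two variables that is smooth as a function on the plane. -/
def SmoothTwo (f : ℝ → ℝ → ℝ) : Prop :=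
  ContDiff ℝ (⊤ : ℕ∞) (fun p : ℝ × ℝ => f p.1 p.2)

namespace SmoothTwo

variable {f : ℝ → ℝ → ℝ}

theorem differentiableAt (hf : SmoothTwo f) (p : ℝ × ℝ) :
    DifferentiableAt ℝ (fun p : ℝ × ℝ => f p.1 p.2) p :=
  ContDiff.differentiable hf (by simp) p

theorem hasDerivAt_fst (hf : SmoothTwo f) (x t : ℝ) :
    HasDerivAt (fun y => f y t)
      (fderiv ℝ (fun p : ℝ × ℝ => f p.1 p.2) (x, t) (1, 0)) x :=
  (hf.differentiableAt (x, t)).hasFDerivAt.comp_hasDerivAt (f := fun y => (y, t)) x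
    ((hasDerivAt_id x).prodMk (hasDerivAt_const x t))

theorem hasDerivAt_snd (hf : SmoothTwo f) (x t : ℝ) :
    HasDerivAt (fun s => f x s)
      (fderiv ℝ (fun p : ℝ × ℝ => f p.1 p.2) (x, t) (0, 1)) t :=
  (hf.differentiableAt (x, t)).hasFDerivAt.comp_hasDerivAt (f := fun s => (x, s)) t
    ((hasDerivAt_const t x).prodMk (hasDerivAt_id t))

theorem pdx_eq (hf : SmoothTwo f) (x t : ℝ) :
    pdx f x t = fderiv ℝ (fun p : ℝ × ℝ => f p.1 p.2) (x, t) (1, 0) :=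
  (hf.hasDerivAt_fst x t).deriv

theorem pdt_eq (hf : SmoothTwo f) (x t : ℝ) :
    pdt f x t = fderiv ℝ (fun p : ℝ × ℝ => f p.1 p.2) (x, t) (0, 1) :=
  (hf.hasDerivAt_snd x t).deriv

theorem hasDerivAt_pdx (hf : SmoothTwo f) (x t : ℝ) :
    HasDerivAt (fun y => f y t) (pdx f x t) x :=
  (hf.hasDerivAt_fst x t).differentiableAt.hasDerivAt

theorem hasDerivAt_pdt (hf : SmoothTwo f) (x t : ℝ) :
    HasDerivAt (fun s => f x s) (pdt f x t) t :=
  (hf.hasDerivAt_snd x t).differentiableAt.hasDerivAt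

theorem contDiff_fderiv (hf : SmoothTwo f) :
    ContDiff ℝ (⊤ : ℕ∞) (fderiv ℝ (fun p : ℝ × ℝ => f p.1 p.2)) :=
  ContDiff.fderiv_right hf (by simp)

protected theorem pdx (hf : SmoothTwo f) : SmoothTwo (pdx f) := by
  simp only [SmoothTwo, hf.pdx_eq]
  exact hf.contDiff_fderiv.clm_apply contDiff_const

protected theorem pdt (hf : SmoothTwo f) : SmoothTwo (pdt f) := by
  simp only [SmoothTwo, hf.pdt_eq]
  exact hf.contDiff_fderiv.clm_apply contDiff_const

/-- Mixed partial derivatives of a smooth function commute. -/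
theorem pdt_pdx (hf : SmoothTwo f) (x t : ℝ) : pdt (pdx f) x t = pdx (pdt f) x t := by
  have hd : DifferentiableAt ℝ (fderiv ℝ (fun p : ℝ × ℝ => f p.1 p.2)) (x, t) :=
    hf.contDiff_fderiv.differentiable (by simp) _
  rw [hf.pdx.pdt_eq, hf.pdt.pdx_eq]
  simp only [hf.pdx_eq, hf.pdt_eq]
  rw [fderiv_clm_apply hd (differentiableAt_const _),
    fderiv_clm_apply hd (differentiableAt_const _)]
  have hs : IsSymmSndFDerivAt ℝ (fun p : ℝ × ℝ => f p.1 p.2) (x, t) :=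
    (ContDiff.contDiffAt hf).isSymmSndFDerivAt (by
      simpa using WithTop.coe_le_coe.2 (le_top : (2 : ℕ∞) ≤ ⊤))
  simpa using hs (0, 1) (1, 0)

end SmoothTwo

theorem hasDerivAt_sum_lt_mul {n : ℕ} (c : Fin n → Fin n → ℝ) {a : Fin n → ℝ → ℝ}
    {a' : Fin n → ℝ} {x : ℝ} (ha : ∀ i, HasDerivAt (a i) (a' i) x) :
    HasDerivAt (fun y => ∑ j : Fin n, ∑ k : Fin n, if j < k then c j k * a j y * a k y else 0)
      (∑ j : Fin n, ∑ k : Fin n,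
        if j < k then c j k * (a' j * a k x + a j x * a' k) else 0) x := by
  refine HasDerivAt.fun_sum fun j _ => HasDerivAt.fun_sum fun k _ => ?_
  split_ifs
  · exact (((ha j).const_mul (c j k)).mul (ha k)).congr_deriv (by ring)
  · exact hasDerivAt_const x 0

/-- smooth solutions of the MCSP equation with 1 + S > 0 satisfy the
    conservation law ∂_t(√(1+S)) = ∂_x((F/2)·√(1+S)). -/
theorem mcsp_conservation_law (n : ℕ) (hn : 1 ≤ n) (c : Fin n → Fin n → ℝ)
    (u : Fin n → ℝ → ℝ → ℝ)
    (hu : ∀ i, ContDiff ℝ (⊤ : ℕ∞) (fun p : ℝ × ℝ => u i p.1 p.2))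
    (hmcsp : ∀ i x t,
      pdx (pdt (u i)) x t
        = u i x t
          + (1/2) * pdx (fun x' t' => Ffun c u x' t' * pdx (u i) x' t') x t)
    (hpos : ∀ x t, 0 < 1 + Sfun c u x t) :
    ∀ x t,
      pdt (fun x' t' => Real.sqrt (1 + Sfun c u x' t')) x t
        = pdx (fun x' t' => (Ffun c u x' t' / 2) * Real.sqrt (1 + Sfun c u x' t')) x t := by
  intro x t
  have hsm : ∀ i, SmoothTwo (u i) := hu
  have hF := hasDerivAt_sum_lt_mul c fun i => (hsm i).hasDerivAt_pdx x t
  have hSx := hasDerivAt_sum_lt_mul c fun i => (hsm i).pdx.hasDerivAt_pdx x t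
  have hSt := hasDerivAt_sum_lt_mul c fun i => (hsm i).pdx.hasDerivAt_pdt x t
  set F' := ∑ j : Fin n, ∑ k : Fin n,
    if j < k then c j k * (pdx (u j) x t * u k x t + u j x t * pdx (u k) x t) else 0 with hF'
  set Sx := ∑ j : Fin n, ∑ k : Fin n, if j < k then
    c j k * (pdx (pdx (u j)) x t * pdx (u k) x t + pdx (u j) x t * pdx (pdx (u k)) x t)
    else 0 with hSx'
  set St := ∑ j : Fin n, ∑ k : Fin n, if j < k then
    c j k * (pdt (pdx (u j)) x t * pdx (u k) x t + pdx (u j) x t * pdt (pdx (u k)) x t)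
    else 0 with hSt'
  change HasDerivAt (fun y => Ffun c u y t) F' x at hF
  change HasDerivAt (fun y => Sfun c u y t) Sx x at hSx
  change HasDerivAt (fun s => Sfun c u x s) St t at hSt
  have hut : ∀ i, pdt (pdx (u i)) x t = u i x t
      + (1/2) * (F' * pdx (u i) x t + Ffun c u x t * pdx (pdx (u i)) x t) := fun i => by
    rw [(hsm i).pdt_pdx, hmcsp]
    congr 2
    exact (hF.mul ((hsm i).pdx.hasDerivAt_pdx x t)).deriv
  have key : St = F' * (1 + Sfun c u x t) + Ffun c u x t * Sx / 2 := by
    have expand : F' * (1 + Sfun c u x t) + Ffun c u x t * Sx / 2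
        = F' + F' * Sfun c u x t + Ffun c u x t / 2 * Sx := by ring
    rw [expand, hSt']
    simp only [hut]
    generalize Ffun c u x t = F
    rw [Sfun, hSx', Finset.mul_sum, Finset.mul_sum]
    nth_rewrite 3 [hF']
    simp only [Finset.mul_sum, ← Finset.sum_add_distrib]
    refine Finset.sum_congr rfl fun j _ => Finset.sum_congr rfl fun k _ => ?_
    split_ifs <;> ring
  have hne := (hpos x t).ne'
  have hL : pdt (fun x' t' => Real.sqrt (1 + Sfun c u x' t')) x t
      = St / (2 * Real.sqrt (1 + Sfun c u x t)) :=
    ((hSt.const_add 1).sqrt hne).deriv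
  have hR : pdx (fun x' t' => (Ffun c u x' t' / 2) * Real.sqrt (1 + Sfun c u x' t')) x t
      = F' / 2 * Real.sqrt (1 + Sfun c u x t)
        + Ffun c u x t / 2 * (Sx / (2 * Real.sqrt (1 + Sfun c u x t))) :=
    ((hF.div_const 2).mul ((hSx.const_add 1).sqrt hne)).deriv
  have hsq := Real.sq_sqrt (hpos x t).le
  have hsne := (Real.sqrt_pos.2 (hpos x t)).ne'
  rw [hL, hR, key]
  generalize Real.sqrt (1 + Sfun c u x t) = r at hsq hsne ⊢
  rw [← hsq]
  field_simp
end

section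
/- Let u^{(1)},…,u^{(n)} : ℝ² → ℝ be smooth solutions of the MCmSP equation with 1 + S(x,t) ≠ 0 for all (x,t). Let φ : ℝ² → ℝ be a smooth function of (X,T) satisfying ∂_X φ(X,T) = 1/(1 + S(φ(X,T),T)) and ∂_T φ(X,T) = −F(φ(X,T),T) for all (X,T). Define U^{(i)}(X,T) := u^{(i)}(φ(X,T),T) and R(X,T) := 1/(1 + S(φ(X,T),T)). Then U and R solve the multi-component coupled integrable dispersionless equations: ∂_X∂_T U^{(i)} = U^{(i)}·(2R − 1) for i = 1,…,n, and ∂_T R + ∂_X( Σ_{1≤j<k≤n} c_{jk} U^{(j)} U^{(k)} ) = 0. -/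
theorem hasDerivAt_prodMk_left {f : ℝ → ℝ → ℝ} {x t : ℝ}
    (hf : DifferentiableAt ℝ (fun p : ℝ × ℝ => f p.1 p.2) (x, t)) :
    HasDerivAt (fun y => f y t) (fderiv ℝ (fun p : ℝ × ℝ => f p.1 p.2) (x, t) (1, 0)) x :=
  HasFDerivAt.comp_hasDerivAt (l := fun p : ℝ × ℝ => f p.1 p.2) x hf.hasFDerivAt
    ((hasDerivAt_id x).prodMk (hasDerivAt_const x t))

theorem hasDerivAt_prodMk_right {f : ℝ → ℝ → ℝ} {x t : ℝ}
    (hf : DifferentiableAt ℝ (fun p : ℝ × ℝ => f p.1 p.2) (x, t)) :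
    HasDerivAt (fun s => f x s) (fderiv ℝ (fun p : ℝ × ℝ => f p.1 p.2) (x, t) (0, 1)) t :=
  HasFDerivAt.comp_hasDerivAt (l := fun p : ℝ × ℝ => f p.1 p.2) t hf.hasFDerivAt
    ((hasDerivAt_const t x).prodMk (hasDerivAt_id t))

theorem pdx_eq_fderiv {f : ℝ → ℝ → ℝ} {x t : ℝ}
    (hf : DifferentiableAt ℝ (fun p : ℝ × ℝ => f p.1 p.2) (x, t)) :
    pdx f x t = fderiv ℝ (fun p : ℝ × ℝ => f p.1 p.2) (x, t) (1, 0) :=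
  (hasDerivAt_prodMk_left hf).deriv

theorem pdt_eq_fderiv {f : ℝ → ℝ → ℝ} {x t : ℝ}
    (hf : DifferentiableAt ℝ (fun p : ℝ × ℝ => f p.1 p.2) (x, t)) :
    pdt f x t = fderiv ℝ (fun p : ℝ × ℝ => f p.1 p.2) (x, t) (0, 1) :=
  (hasDerivAt_prodMk_right hf).deriv

theorem hasDerivAt_pdx {f : ℝ → ℝ → ℝ} {x t : ℝ}
    (hf : DifferentiableAt ℝ (fun p : ℝ × ℝ => f p.1 p.2) (x, t)) :
    HasDerivAt (fun y => f y t) (pdx f x t) x :=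
  pdx_eq_fderiv hf ▸ hasDerivAt_prodMk_left hf

theorem hasDerivAt_pdt {f : ℝ → ℝ → ℝ} {x t : ℝ}
    (hf : DifferentiableAt ℝ (fun p : ℝ × ℝ => f p.1 p.2) (x, t)) :
    HasDerivAt (fun s => f x s) (pdt f x t) t :=
  pdt_eq_fderiv hf ▸ hasDerivAt_prodMk_right hf

theorem differentiable_pdx {f : ℝ → ℝ → ℝ}
    (hf : ContDiff ℝ 2 (fun p : ℝ × ℝ => f p.1 p.2)) :
    Differentiable ℝ (fun p : ℝ × ℝ => pdx f p.1 p.2) := by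
  have hd := hf.differentiable two_ne_zero
  have h : (fun p : ℝ × ℝ => pdx f p.1 p.2)
      = fun p => fderiv ℝ (fun p : ℝ × ℝ => f p.1 p.2) p (1, 0) :=
    funext fun p => pdx_eq_fderiv (hd _)
  rw [h]
  have h1 : ContDiff ℝ 1 (fderiv ℝ (fun p : ℝ × ℝ => f p.1 p.2)) :=
    hf.fderiv_right (by norm_num)
  exact (h1.differentiable one_ne_zero).clm_apply (differentiable_const _)

theorem differentiable_pdt {f : ℝ → ℝ → ℝ}
    (hf : ContDiff ℝ 2 (fun p : ℝ × ℝ => f p.1 p.2)) :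
    Differentiable ℝ (fun p : ℝ × ℝ => pdt f p.1 p.2) := by
  have hd := hf.differentiable two_ne_zero
  have h : (fun p : ℝ × ℝ => pdt f p.1 p.2)
      = fun p => fderiv ℝ (fun p : ℝ × ℝ => f p.1 p.2) p (0, 1) :=
    funext fun p => pdt_eq_fderiv (hd _)
  rw [h]
  have h1 : ContDiff ℝ 1 (fderiv ℝ (fun p : ℝ × ℝ => f p.1 p.2)) :=
    hf.fderiv_right (by norm_num)
  exact (h1.differentiable one_ne_zero).clm_apply (differentiable_const _)

/-- Symmetry of mixed partial derivatives. -/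
theorem pdt_pdx_comm {f : ℝ → ℝ → ℝ}
    (hf : ContDiff ℝ 2 (fun p : ℝ × ℝ => f p.1 p.2)) (x t : ℝ) :
    pdt (pdx f) x t = pdx (pdt f) x t := by
  have hd := hf.differentiable two_ne_zero
  have h1 : DifferentiableAt ℝ (fderiv ℝ (fun p : ℝ × ℝ => f p.1 p.2)) (x, t) :=
    (hf.fderiv_right (m := 1) (by norm_num)).differentiable one_ne_zero _
  have hX : (fun p : ℝ × ℝ => pdx f p.1 p.2)
      = fun p => fderiv ℝ (fun p : ℝ × ℝ => f p.1 p.2) p (1, 0) :=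
    funext fun p => pdx_eq_fderiv (hd _)
  have hT : (fun p : ℝ × ℝ => pdt f p.1 p.2)
      = fun p => fderiv ℝ (fun p : ℝ × ℝ => f p.1 p.2) p (0, 1) :=
    funext fun p => pdt_eq_fderiv (hd _)
  rw [pdt_eq_fderiv (differentiable_pdx hf _), pdx_eq_fderiv (differentiable_pdt hf _), hX, hT,
    fderiv_clm_apply h1 (differentiableAt_const _), fderiv_clm_apply h1 (differentiableAt_const _)]
  simpa using (hf.contDiffAt.isSymmSndFDerivAt (by simp)).eq (0, 1) (1, 0)

theorem differentiable_Ffun {n : ℕ} (c : Fin n → Fin n → ℝ) {u : Fin n → ℝ → ℝ → ℝ}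
    (hu : ∀ i, Differentiable ℝ (fun p : ℝ × ℝ => u i p.1 p.2)) :
    Differentiable ℝ (fun p : ℝ × ℝ => Ffun c u p.1 p.2) := by
  unfold Ffun
  refine Differentiable.fun_sum fun j _ => Differentiable.fun_sum fun k _ => ?_
  split_ifs
  · exact ((hu j).const_mul (c j k)).mul (hu k)
  · exact differentiable_const _

/-- Chain rule for the time derivative along a moving point. -/
theorem pdt_comp {f φ : ℝ → ℝ → ℝ} {X T : ℝ}
    (hf : DifferentiableAt ℝ (fun p : ℝ × ℝ => f p.1 p.2) (φ X T, T))
    (hφ : DifferentiableAt ℝ (fun p : ℝ × ℝ => φ p.1 p.2) (X, T)) :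
    pdt (fun X T => f (φ X T) T) X T
      = pdx f (φ X T) T * pdt φ X T + pdt f (φ X T) T := by
  have h := HasFDerivAt.comp_hasDerivAt (f := fun s => (φ X s, s)) T hf.hasFDerivAt
    ((hasDerivAt_pdt hφ).prodMk (hasDerivAt_id T))
  have hv : ((pdt φ X T, 1) : ℝ × ℝ) = pdt φ X T • (1, 0) + (0, 1) := by simp
  rw [hv, map_add, map_smul, ← pdx_eq_fderiv hf, ← pdt_eq_fderiv hf, smul_eq_mul, mul_comm] at h
  exact h.deriv

/-- Chain rule for the space derivative along a reparametrised point. -/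
theorem pdx_comp {f φ : ℝ → ℝ → ℝ} {X T : ℝ}
    (hf : DifferentiableAt ℝ (fun p : ℝ × ℝ => f p.1 p.2) (φ X T, T))
    (hφ : DifferentiableAt ℝ (fun p : ℝ × ℝ => φ p.1 p.2) (X, T)) :
    pdx (fun X T => f (φ X T) T) X T = pdx f (φ X T) T * pdx φ X T :=
  (HasDerivAt.comp (h₂ := fun y => f y T) X (hasDerivAt_pdx hf) (hasDerivAt_pdx hφ)).deriv

/-- the hodograph transformation maps smooth solutions of the MCmSP
    equation to solutions of the multi-component coupled integrable dispersionless
    equations. -/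
theorem mcmsp_hodograph_to_dispersionless (n : ℕ) (hn : 1 ≤ n)
    (c : Fin n → Fin n → ℝ) (u : Fin n → ℝ → ℝ → ℝ)
    (hu : ∀ i, ContDiff ℝ (⊤ : ℕ∞) (fun p : ℝ × ℝ => u i p.1 p.2))
    (hmcmsp : ∀ i x t,
      pdx (pdt (u i)) x t
        = u i x t
          + pdx (fun x' t' => Ffun c u x' t' * pdx (u i) x' t') x t
          - Sfun c u x t * u i x t)
    (hSne : ∀ x t, 1 + Sfun c u x t ≠ 0)
    (φ : ℝ → ℝ → ℝ)
    (hφ : ContDiff ℝ (⊤ : ℕ∞) (fun p : ℝ × ℝ => φ p.1 p.2))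
    (hφX : ∀ X T, pdx φ X T = 1 / (1 + Sfun c u (φ X T) T))
    (hφT : ∀ X T, pdt φ X T = - Ffun c u (φ X T) T)
    (U : Fin n → ℝ → ℝ → ℝ)
    (hU : ∀ i X T, U i X T = u i (φ X T) T)
    (R : ℝ → ℝ → ℝ)
    (hR : ∀ X T, R X T = 1 / (1 + Sfun c u (φ X T) T)) :
    (∀ i X T, pdx (pdt (U i)) X T = U i X T * (2 * R X T - 1)) ∧
    (∀ X T,
      pdt R X T
        + pdx (fun X' T' => ∑ j : Fin n, ∑ k : Fin n,
            if j < k then c j k * U j X' T' * U k X' T' else 0) X T = 0) := by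
  obtain rfl : U = fun i X T => u i (φ X T) T := by ext; exact hU ..
  obtain rfl : R = pdx φ := by ext; rw [hR, hφX]
  have hu2 i : ContDiff ℝ 2 (fun p : ℝ × ℝ => u i p.1 p.2) :=
    mod_cast contDiff_infty.1 (hu i) 2
  have hφ2 : ContDiff ℝ 2 (fun p : ℝ × ℝ => φ p.1 p.2) := mod_cast contDiff_infty.1 hφ 2
  have hud i := (hu2 i).differentiable two_ne_zero
  have hφd := hφ2.differentiable two_ne_zero
  have hFd := differentiable_Ffun c hud
  refine ⟨fun i X T => ?_, fun X T => ?_⟩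
  · let g : ℝ → ℝ → ℝ := fun x t => pdt (u i) x t - Ffun c u x t * pdx (u i) x t
    have hFu : Differentiable ℝ (fun p : ℝ × ℝ => Ffun c u p.1 p.2 * pdx (u i) p.1 p.2) :=
      hFd.mul (differentiable_pdx (hu2 i))
    have hg : Differentiable ℝ (fun p : ℝ × ℝ => g p.1 p.2) :=
      (differentiable_pdt (hu2 i)).sub hFu
    have hUT : pdt (fun X T => u i (φ X T) T) = fun X T => g (φ X T) T := by
      ext X T
      rw [pdt_comp (hud i _) (hφd _), hφT]
      ring
    have hgx x t : pdx g x t = u i x t - Sfun c u x t * u i x t := by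
      have h : pdx g x t = pdx (pdt (u i)) x t
          - pdx (fun x' t' => Ffun c u x' t' * pdx (u i) x' t') x t :=
        ((hasDerivAt_pdx (differentiable_pdt (hu2 i) _)).sub
          (hasDerivAt_pdx (f := fun x' t' => Ffun c u x' t' * pdx (u i) x' t') (hFu _))).deriv
      rw [h, hmcmsp]
      ring
    rw [hUT, pdx_comp (hg _) (hφd _), hgx, hφX]
    have := hSne (φ X T) T
    field_simp
    ring
  · have hφT' : pdt φ = fun X T => -Ffun c u (φ X T) T := by ext; exact hφT ..
    rw [pdt_pdx_comm hφ2, hφT']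
    simp only [pdx, deriv.fun_neg]
    exact neg_add_cancel _
end

section
/- Let a ≠ 0 be a real constant. For each l ∈ ℤ let f_l, g_l^{(1)},…,g_l^{(n)} : ℝ → ℝ be smooth functions of T with f_l nowhere zero, satisfying the semi-discrete bilinear system: (i) (1/a)·[ (g_{l+1}^{(i)})' f_l − g_{l+1}^{(i)} f_l' − (g_l^{(i)})' f_{l+1} + g_l^{(i)} f_{l+1}' ] = g_{l+1}^{(i)} f_l + g_l^{(i)} f_{l+1} for all l and i = 1,…,n; and (ii) f_l'' f_l − (f_l')² = Σ_{1≤j<k≤n} c_{jk} g_l^{(j)} g_l^{(k)} for all l. Then u_l^{(i)} := g_l^{(i)}/f_l and ρ_l := 1 − (1/(2a))·( f_{l+1}'/f_{l+1} − f_l'/f_l ) satisfy the semi-discrete multi-component coupled integrable dispersionless equations: d/dT ( u_{l+1}^{(i)} − u_l^{(i)} ) = a·(2ρ_l − 1)·( u_{l+1}^{(i)} + u_l^{(i)} ) and d/dT ρ_l = −(1/(2a)) Σ_{1≤j<k≤n} c_{jk} ( u_{l+1}^{(j)} u_{l+1}^{(k)} − u_l^{(j)} u_l^{(k)} ). -/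
/-- Derivative of the logarithmic derivative at a point where the function does not vanish. -/
theorem hasDerivAt_deriv_div_self {f : ℝ → ℝ} {T : ℝ} (hf : ContDiff ℝ 2 f) (h0 : f T ≠ 0) :
    HasDerivAt (fun t => deriv f t / f t)
      ((deriv (deriv f) T * f T - deriv f T ^ 2) / f T ^ 2) T := by
  have hf' : DifferentiableAt ℝ f T := hf.differentiable (by norm_num) T
  have hf'' : DifferentiableAt ℝ (deriv f) T := by
    have : ContDiff ℝ 1 (deriv f) := hf.deriv'
    exact this.differentiable (by norm_num) T
  simpa only [sq (deriv f T)] using hf''.hasDerivAt.fun_div hf'.hasDerivAt h0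

/-- the semi-discrete bilinear MCmSP system yields, via the dependent
    variable transformation u_l^{(i)} = g_l^{(i)}/f_l,
    ρ_l = 1 − (1/(2a))(log(f_{l+1}/f_l))_T, solutions of the semi-discrete
    multi-component coupled integrable dispersionless equations. -/
theorem semidiscrete_mcmsp_bilinear_to_dispersionless (n : ℕ) (hn : 1 ≤ n)
    (c : Fin n → Fin n → ℝ) (a : ℝ) (ha : a ≠ 0)
    (f : ℤ → ℝ → ℝ) (g : Fin n → ℤ → ℝ → ℝ)
    (hf : ∀ l, ContDiff ℝ (⊤ : ℕ∞) (f l))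
    (hg : ∀ i l, ContDiff ℝ (⊤ : ℕ∞) (g i l))
    (hfne : ∀ l T, f l T ≠ 0)
    (hbil1 : ∀ (i : Fin n) (l : ℤ) (T : ℝ),
      (1/a) * (deriv (g i (l+1)) T * f l T - g i (l+1) T * deriv (f l) T
        - deriv (g i l) T * f (l+1) T + g i l T * deriv (f (l+1)) T)
        = g i (l+1) T * f l T + g i l T * f (l+1) T)
    (hbil2 : ∀ (l : ℤ) (T : ℝ),
      deriv (deriv (f l)) T * f l T - (deriv (f l) T)^2
        = ∑ j : Fin n, ∑ k : Fin n,
            if j < k then c j k * g j l T * g k l T else 0)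
    (u : Fin n → ℤ → ℝ → ℝ)
    (hu : ∀ i l T, u i l T = g i l T / f l T)
    (ρ : ℤ → ℝ → ℝ)
    (hρ : ∀ l T,
      ρ l T = 1 - (1/(2*a)) * (deriv (f (l+1)) T / f (l+1) T - deriv (f l) T / f l T)) :
    (∀ (i : Fin n) (l : ℤ) (T : ℝ),
      deriv (fun T' => u i (l+1) T' - u i l T') T
        = a * (2 * ρ l T - 1) * (u i (l+1) T + u i l T)) ∧
    (∀ (l : ℤ) (T : ℝ),
      deriv (ρ l) T
        = -(1/(2*a)) * ∑ j : Fin n, ∑ k : Fin n,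
            if j < k then c j k * (u j (l+1) T * u k (l+1) T - u j l T * u k l T)
            else 0) := by
  constructor
  · intro i l T
    have hfd (m : ℤ) : DifferentiableAt ℝ (f m) T := (hf m).differentiable (by simp) T
    have hgd (m : ℤ) : DifferentiableAt ℝ (g i m) T := (hg i m).differentiable (by simp) T
    have hderiv := (((hgd (l + 1)).hasDerivAt.fun_div (hfd (l + 1)).hasDerivAt
      (hfne (l + 1) T)).fun_sub
        ((hgd l).hasDerivAt.fun_div (hfd l).hasDerivAt (hfne l T))).deriv
    simp only [hu, hρ, hderiv]
    have hbil := hbil1 i l T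
    have hne := hfne l T
    have hne' := hfne (l + 1) T
    field_simp at hbil ⊢
    linear_combination f l T * f (l + 1) T * hbil
  · intro l T
    have hlog (m : ℤ) : HasDerivAt (fun t => deriv (f m) t / f m t)
        (∑ j : Fin n, ∑ k : Fin n, if j < k then c j k * (u j m T * u k m T) else 0) T := by
      convert hasDerivAt_deriv_div_self (contDiff_infty.1 (hf m) 2) (hfne m T) using 1
      rw [hbil2, Finset.sum_div]
      refine Finset.sum_congr rfl fun j _ => ?_
      rw [Finset.sum_div]
      refine Finset.sum_congr rfl fun k _ => ?_
      have hne := hfne m T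
      split_ifs
      · rw [hu, hu]
        field_simp
      · simp
    rw [funext (hρ l),
      ((((hlog (l + 1)).fun_sub (hlog l)).const_mul (1 / (2 * a))).const_sub 1).deriv,
      neg_mul, ← Finset.sum_sub_distrib]
    congr 2
    refine Finset.sum_congr rfl fun j _ => ?_
    rw [← Finset.sum_sub_distrib]
    refine Finset.sum_congr rfl fun k _ => ?_
    split_ifs <;> ring
end

section
/- Let a ≠ 0 be a real constant. For each l ∈ ℤ let f_l, g_l^{(1)},…,g_l^{(n)} : ℝ → ℝ be smooth functions of T with f_l nowhere zero, satisfying: (i) (1/a)·[ (g_{l+1}^{(i)})' f_l − g_{l+1}^{(i)} f_l' − (g_l^{(i)})' f_{l+1} + g_l^{(i)} f_{l+1}' ] = g_{l+1}^{(i)} f_l + g_l^{(i)} f_{l+1} for all l and i = 1,…,n; and (ii) f_l'' f_l − (f_l')² = (1/4) Σ_{1≤j<k≤n} c_{jk} g_l^{(j)} g_l^{(k)} for all l. Then u_l^{(i)} := g_l^{(i)}/f_l and ρ_l := 1 − (1/a)·( f_{l+1}'/f_{l+1} − f_l'/f_l ) satisfy: d/dT ( u_{l+1}^{(i)} − u_l^{(i)}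 ) = a·ρ_l·( u_{l+1}^{(i)} + u_l^{(i)} ) and d/dT ρ_l = −(1/(4a)) Σ_{1≤j<k≤n} c_{jk} ( u_{l+1}^{(j)} u_{l+1}^{(k)} − u_l^{(j)} u_l^{(k)} ). -/
/-- If `F'' F - F'² = S / 4`, then the logarithmic derivative of `F` has derivative
`(S / F²) / 4`. -/
theorem hasDerivAt_logarithmic_deriv {F : ℝ → ℝ} (hF : ContDiff ℝ (⊤ : ℕ∞) F) {T S : ℝ}
    (h0 : F T ≠ 0)
    (h : deriv (deriv F) T * F T - (deriv F T) ^ 2 = (1 / 4) * S) :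
    HasDerivAt (fun t => deriv F t / F t) ((1 / 4) * (S / (F T) ^ 2)) T := by
  have h1 : HasDerivAt F (deriv F T) T := (hF.differentiable (by simp) T).hasDerivAt
  have hF' : ContDiff ℝ (⊤ : ℕ∞) (deriv F) := (contDiff_infty_iff_deriv.mp hF).2
  have h2 : HasDerivAt (deriv F) (deriv (deriv F) T) T :=
    (hF'.differentiable (by simp) T).hasDerivAt
  refine (h2.div h1 h0).congr_deriv ?_
  rw [← sq, h, mul_div_assoc]

/-- the semi-discrete bilinear MCSP system yields, via the dependent
    variable transformation u_l^{(i)} = g_l^{(i)}/f_l,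
    ρ_l = 1 − (1/a)(log(f_{l+1}/f_l))_T, solutions of the semi-discrete
    multi-component coupled integrable dispersionless equations (MCSP version). -/
theorem semidiscrete_mcsp_bilinear_to_dispersionless (n : ℕ) (hn : 1 ≤ n)
    (c : Fin n → Fin n → ℝ) (a : ℝ) (ha : a ≠ 0)
    (f : ℤ → ℝ → ℝ) (g : Fin n → ℤ → ℝ → ℝ)
    (hf : ∀ l, ContDiff ℝ (⊤ : ℕ∞) (f l))
    (hg : ∀ i l, ContDiff ℝ (⊤ : ℕ∞) (g i l))
    (hfne : ∀ l T, f l T ≠ 0)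
    (hbil1 : ∀ (i : Fin n) (l : ℤ) (T : ℝ),
      (1/a) * (deriv (g i (l+1)) T * f l T - g i (l+1) T * deriv (f l) T
        - deriv (g i l) T * f (l+1) T + g i l T * deriv (f (l+1)) T)
        = g i (l+1) T * f l T + g i l T * f (l+1) T)
    (hbil2 : ∀ (l : ℤ) (T : ℝ),
      deriv (deriv (f l)) T * f l T - (deriv (f l) T)^2
        = (1/4) * ∑ j : Fin n, ∑ k : Fin n,
            if j < k then c j k * g j l T * g k l T else 0)
    (u : Fin n → ℤ → ℝ → ℝ)
    (hu : ∀ i l T, u i l T = g i l T / f l T)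
    (ρ : ℤ → ℝ → ℝ)
    (hρ : ∀ l T,
      ρ l T = 1 - (1/a) * (deriv (f (l+1)) T / f (l+1) T - deriv (f l) T / f l T)) :
    (∀ (i : Fin n) (l : ℤ) (T : ℝ),
      deriv (fun T' => u i (l+1) T' - u i l T') T
        = a * ρ l T * (u i (l+1) T + u i l T)) ∧
    (∀ (l : ℤ) (T : ℝ),
      deriv (ρ l) T
        = -(1/(4*a)) * ∑ j : Fin n, ∑ k : Fin n,
            if j < k then c j k * (u j (l+1) T * u k (l+1) T - u j l T * u k l T)
            else 0) := by
  constructor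
  · intro i l T
    have hu' (m : ℤ) : u i m = fun t => g i m t / f m t := funext (hu i m)
    have hd (m : ℤ) : HasDerivAt (u i m)
        ((deriv (g i m) T * f m T - g i m T * deriv (f m) T) / (f m T) ^ 2) T := by
      rw [hu']
      exact ((hg i m).differentiable (by simp) T).hasDerivAt.div
        ((hf m).differentiable (by simp) T).hasDerivAt (hfne m T)
    have hb := hbil1 i l T
    have h0 := hfne l T
    have h1 := hfne (l + 1) T
    refine ((hd (l + 1)).sub (hd l)).deriv.trans ?_
    rw [hρ, hu, hu]
    field_simp at hb ⊢
    linear_combination (f l T * f (l + 1) T) * hb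
  · intro l T
    have hlog (m : ℤ) := hasDerivAt_logarithmic_deriv (hf m) (hfne m T) (hbil2 m T)
    rw [funext (hρ l)]
    refine ((((hlog (l + 1)).sub (hlog l)).const_mul (1 / a)).const_sub 1).deriv.trans ?_
    have hsum (m : ℤ) : (∑ j : Fin n, ∑ k : Fin n,
          if j < k then c j k * g j m T * g k m T else 0) / (f m T) ^ 2 =
        ∑ j : Fin n, ∑ k : Fin n, if j < k then c j k * (u j m T * u k m T) else 0 := by
      simp only [Finset.sum_div, hu]
      refine Finset.sum_congr rfl fun j _ => Finset.sum_congr rfl fun k _ => ?_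
      split_ifs
      · ring
      · simp
    have hdiff : (∑ j : Fin n, ∑ k : Fin n,
          if j < k then c j k * (u j (l + 1) T * u k (l + 1) T - u j l T * u k l T) else 0) =
        (∑ j : Fin n, ∑ k : Fin n,
          if j < k then c j k * (u j (l + 1) T * u k (l + 1) T) else 0) -
        ∑ j : Fin n, ∑ k : Fin n, if j < k then c j k * (u j l T * u k l T) else 0 := by
      simp only [← Finset.sum_sub_distrib]
      refine Finset.sum_congr rfl fun j _ => Finset.sum_congr rfl fun k _ => ?_
      split_ifs <;> ring
    rw [hsum, hsum, hdiff]
    ring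
end

section
/- Let a ≠ 0 be a real constant. For each l ∈ ℕ let u_l^{(1)},…,u_l^{(n)}, ρ_l : ℝ → ℝ be differentiable functions of T satisfying d/dT ρ_l = −(1/(2a)) Σ_{1≤j<k≤n} c_{jk} ( u_{l+1}^{(j)} u_{l+1}^{(k)} − u_l^{(j)} u_l^{(k)} ) for all l. Let x_0 : ℝ → ℝ be differentiable with d/dT x_0 = −Σ_{1≤j<k≤n} c_{jk} u_0^{(j)} u_0^{(k)} (the consistency condition with the hodograph transformation), and for l ≥ 1 define x_l(T) := x_0(T) + Σ_{m=0}^{l-1} 2a·ρ_m(T). Then for every l ∈ ℕ, d/dT x_l = −Σ_{1≤j<k≤n} c_{jk} u_l^{(j)} u_l^{(k)}; i.e. the mesh points of the self-adaptive moving mesh scheme for the MCmSP equation under general boundary conditions all evolve by dx_l/dT = −Σ_{j<k} c_{jk} u_l^{(j)} u_l^{(k)}. -/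
/-- under the consistency condition with the hodograph transformation,
    all mesh points of the self-adaptive moving mesh scheme for the MCmSP equation
    evolve by dx_l/dT = −Σ_{j<k} c_{jk} u_l^{(j)} u_l^{(k)}. -/
theorem mcmsp_mesh_point_evolution (n : ℕ) (hn : 1 ≤ n)
    (c : Fin n → Fin n → ℝ) (a : ℝ) (ha : a ≠ 0)
    (u : Fin n → ℕ → ℝ → ℝ) (ρ : ℕ → ℝ → ℝ)
    (hud : ∀ i l, Differentiable ℝ (u i l))
    (hρd : ∀ l, Differentiable ℝ (ρ l))
    (hρ : ∀ (l : ℕ) (T : ℝ),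
      deriv (ρ l) T
        = -(1/(2*a)) * ∑ j : Fin n, ∑ k : Fin n,
            if j < k then c j k * (u j (l+1) T * u k (l+1) T - u j l T * u k l T)
            else 0)
    (x₀ : ℝ → ℝ) (hx₀d : Differentiable ℝ x₀)
    (hx₀ : ∀ T : ℝ,
      deriv x₀ T
        = -∑ j : Fin n, ∑ k : Fin n,
            if j < k then c j k * u j 0 T * u k 0 T else 0)
    (x : ℕ → ℝ → ℝ)
    (hx : ∀ (l : ℕ) (T : ℝ),
      x l T = x₀ T + ∑ m ∈ Finset.range l, 2 * a * ρ m T) :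
    ∀ (l : ℕ) (T : ℝ),
      deriv (x l) T
        = -∑ j : Fin n, ∑ k : Fin n,
            if j < k then c j k * u j l T * u k l T else 0 := by
  suffices h : ∀ (l : ℕ) (T : ℝ), HasDerivAt (x l)
      (-∑ j : Fin n, ∑ k : Fin n, if j < k then c j k * u j l T * u k l T else 0) T from
    fun l T => (h l T).deriv
  intro l T
  induction l with
  | zero =>
    have hx0 : x 0 = x₀ := by
      funext t
      simp [hx]
    rw [hx0, ← hx₀ T]
    exact (hx₀d T).hasDerivAt
  | succ l ih =>
    have hstep : x (l + 1) = fun t => x l t + 2 * a * ρ l t := by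
      funext t
      rw [hx, hx, Finset.sum_range_succ, add_assoc]
    have hsplit : (∑ j : Fin n, ∑ k : Fin n,
          if j < k then c j k * (u j (l+1) T * u k (l+1) T - u j l T * u k l T) else 0)
        = (∑ j : Fin n, ∑ k : Fin n,
            if j < k then c j k * u j (l+1) T * u k (l+1) T else 0)
          - ∑ j : Fin n, ∑ k : Fin n, if j < k then c j k * u j l T * u k l T else 0 := by
      simp_rw [← Finset.sum_sub_distrib]
      refine Finset.sum_congr rfl fun j _ => Finset.sum_congr rfl fun k _ => ?_
      split_ifs <;> ring
    rw [hstep]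
    refine (ih.add ((hρd l T).hasDerivAt.const_mul (2 * a))).congr_deriv ?_
    rw [hρ, hsplit]
    field_simp
    ring
end

section
/- Let p_1, p_2 be nonzero reals with p_1 + p_2 ≠ 0, and let a_1, a_2, ξ_1, ξ_2 ∈ ℝ. Set b_{12} = (p_1 p_2/(p_1+p_2))² and η_j(X,T) = p_j X + T/p_j + ξ_j. Define f := −1 − a_1 a_2 b_{12} e^{η_1+η_2}, g^{(1)} := −a_1 e^{η_1}, g^{(2)} := −a_2 e^{η_2}. Then f, g^{(1)}, g^{(2)} satisfy the bilinear form of the 2-component modified short pulse equation: f_{XT} g^{(i)} − f_X g^{(i)}_T − f_T g^{(i)}_X + f g^{(i)}_{XT} = f·g^{(i)} for i = 1,2, and f_{TT} f − (f_T)² = g^{(1)} g^{(2)}. -/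
theorem pdx_const_add_mul_exp (c A k w m : ℝ) :
    pdx (fun X T => c + A * Real.exp (k * X + w * T + m)) =
      fun X T => 0 + A * k * Real.exp (k * X + w * T + m) := by
  funext X T
  have h : HasDerivAt (fun y : ℝ => k * y + w * T + m) k X := by
    simpa using (((hasDerivAt_id X).const_mul k).add_const (w * T)).add_const m
  rw [pdx, ((h.exp.const_mul A).const_add c).deriv]
  ring

theorem pdt_const_add_mul_exp (c A k w m : ℝ) :
    pdt (fun X T => c + A * Real.exp (k * X + w * T + m)) =
      fun X T => 0 + A * w * Real.exp (k * X + w * T + m) := by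
  funext X T
  have h : HasDerivAt (fun s : ℝ => k * X + w * s + m) w T := by
    simpa using (((hasDerivAt_id T).const_mul w).const_add (k * X)).add_const m
  rw [pdt, ((h.exp.const_mul A).const_add c).deriv]
  ring

/-- the one-soliton tau functions satisfy the bilinear form of the
    2-component modified short pulse equation. -/
theorem twoComponent_mSP_one_soliton (p₁ p₂ : ℝ)
    (hp₁ : p₁ ≠ 0) (hp₂ : p₂ ≠ 0) (hp : p₁ + p₂ ≠ 0)
    (a₁ a₂ ξ₁ ξ₂ : ℝ)
    (b₁₂ : ℝ) (hb : b₁₂ = (p₁ * p₂ / (p₁ + p₂))^2)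
    (η₁ η₂ : ℝ → ℝ → ℝ)
    (hη₁ : ∀ X T, η₁ X T = p₁ * X + T / p₁ + ξ₁)
    (hη₂ : ∀ X T, η₂ X T = p₂ * X + T / p₂ + ξ₂)
    (f g₁ g₂ : ℝ → ℝ → ℝ)
    (hf : ∀ X T, f X T = -1 - a₁ * a₂ * b₁₂ * Real.exp (η₁ X T + η₂ X T))
    (hg₁ : ∀ X T, g₁ X T = -a₁ * Real.exp (η₁ X T))
    (hg₂ : ∀ X T, g₂ X T = -a₂ * Real.exp (η₂ X T)) :
    (∀ X T,
      pdx (pdt f) X T * g₁ X T - pdx f X T * pdt g₁ X T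
        - pdt f X T * pdx g₁ X T + f X T * pdx (pdt g₁) X T
        = f X T * g₁ X T) ∧
    (∀ X T,
      pdx (pdt f) X T * g₂ X T - pdx f X T * pdt g₂ X T
        - pdt f X T * pdx g₂ X T + f X T * pdx (pdt g₂) X T
        = f X T * g₂ X T) ∧
    (∀ X T,
      pdt (pdt f) X T * f X T - (pdt f X T)^2 = g₁ X T * g₂ X T) := by
  have hF : f = fun X T => -1 + -(a₁ * a₂ * b₁₂) *
      Real.exp ((p₁ + p₂) * X + (1 / p₁ + 1 / p₂) * T + (ξ₁ + ξ₂)) := by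
    funext X T
    rw [hf, hη₁, hη₂]
    ring_nf
  have hG₁ : g₁ = fun X T => 0 + -a₁ * Real.exp (p₁ * X + 1 / p₁ * T + ξ₁) := by
    funext X T
    rw [hg₁, hη₁]
    ring_nf
  have hG₂ : g₂ = fun X T => 0 + -a₂ * Real.exp (p₂ * X + 1 / p₂ * T + ξ₂) := by
    funext X T
    rw [hg₂, hη₂]
    ring_nf
  have hE : ∀ X T, Real.exp ((p₁ + p₂) * X + (1 / p₁ + 1 / p₂) * T + (ξ₁ + ξ₂)) =
      Real.exp (p₁ * X + 1 / p₁ * T + ξ₁) * Real.exp (p₂ * X + 1 / p₂ * T + ξ₂) := by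
    intro X T
    rw [← Real.exp_add]
    ring_nf
  clear hf hg₁ hg₂
  subst hF hG₁ hG₂
  simp only [pdt_const_add_mul_exp, pdx_const_add_mul_exp]
  simp only [hE]
  refine ⟨fun X T => ?_, fun X T => ?_, fun X T => ?_⟩ <;>
  · generalize Real.exp (p₁ * X + 1 / p₁ * T + ξ₁) = E₁
    generalize Real.exp (p₂ * X + 1 / p₂ * T + ξ₂) = E₂
    subst hb
    field_simp
    ring
end

section
/- Let p_1, p_2, p_3, p_4 be nonzero reals with p_j + p_k ≠ 0 for all j ∈ {1,2}, k ∈ {3,4}, and let a_1,…,a_4, ξ_1,…,ξ_4 ∈ ℝ. Set b_{jk} = (p_j p_k/(p_j+p_k))² and η_j(X,T) = p_j X + T/p_j + ξ_j. Define f := 1 + a_1a_3 b_{13} e^{η_1+η_3} + a_2a_3 b_{23} e^{η_2+η_3} + a_1a_4 b_{14} e^{η_1+η_4} + a_2a_4 b_{24} e^{η_2+η_4} + a_1a_2a_3a_4 (p_1−p_2)²(p_3−p_4)² · b_{13}b_{23}b_{14}b_{24}/(p_1²p_2²p_3²p_4²) · e^{η_1+η_2+η_3+η_4}, g^{(1)}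 := a_1 e^{η_1} + a_2 e^{η_2} + a_1a_2a_3 (p_1−p_2)² p_3⁴/((p_1+p_3)²(p_2+p_3)²) e^{η_1+η_2+η_3} + a_1a_2a_4 (p_1−p_2)² p_4⁴/((p_1+p_4)²(p_2+p_4)²) e^{η_1+η_2+η_4}, g^{(2)} := a_3 e^{η_3} + a_4 e^{η_4} + a_2a_3a_4 (p_3−p_4)² p_2⁴/((p_2+p_3)²(p_2+p_4)²) e^{η_2+η_3+η_4} + a_1a_3a_4 (p_3−p_4)² p_1⁴/((p_1+p_3)²(p_1+p_4)²) e^{η_1+η_3+η_4}. Then f_{XT} g^{(i)} − f_X g^{(i)}_T − f_T g^{(i)}_X + f g^{(i)}_{XT} = f·g^{(i)} for i = 1,2, and f_{TT} f − (f_T)² = g^{(1)} g^{(2)}. -/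
noncomputable def expSum {n : ℕ} (c k w d : Fin n → ℝ) (x t : ℝ) : ℝ :=
  ∑ i, c i * Real.exp (k i * x + w i * t + d i)

theorem pdx_expSum {n : ℕ} (c k w d : Fin n → ℝ) :
    pdx (expSum c k w d) = expSum (fun i => c i * k i) k w d := by
  funext x t
  refine HasDerivAt.deriv (HasDerivAt.fun_sum fun i _ => ?_)
  have h : HasDerivAt (fun y => k i * y + w i * t + d i) (k i) x := by
    simpa using (((hasDerivAt_id x).const_mul (k i)).add_const (w i * t)).add_const (d i)
  exact (h.exp.const_mul (c i)).congr_deriv (by ring)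

theorem pdt_expSum {n : ℕ} (c k w d : Fin n → ℝ) :
    pdt (expSum c k w d) = expSum (fun i => c i * w i) k w d := by
  funext x t
  refine HasDerivAt.deriv (HasDerivAt.fun_sum fun i _ => ?_)
  have h : HasDerivAt (fun s => k i * x + w i * s + d i) (w i) t := by
    simpa using (((hasDerivAt_id t).const_mul (w i)).const_add (k i * x)).add_const (d i)
  exact (h.exp.const_mul (c i)).congr_deriv (by ring)

/-- The bilinear operator `D_x D_t F · G - F G` on sums of exponentials. -/
theorem hirota_xt_expSum {m n : ℕ} (c k w d : Fin m → ℝ) (c' k' w' d' : Fin n → ℝ) (x t : ℝ) :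
    pdx (pdt (expSum c k w d)) x t * expSum c' k' w' d' x t
      - pdx (expSum c k w d) x t * pdt (expSum c' k' w' d') x t
      - pdt (expSum c k w d) x t * pdx (expSum c' k' w' d') x t
      + expSum c k w d x t * pdx (pdt (expSum c' k' w' d')) x t
      - expSum c k w d x t * expSum c' k' w' d' x t =
    ∑ i, ∑ j, (c i * Real.exp (k i * x + w i * t + d i)) *
      (c' j * Real.exp (k' j * x + w' j * t + d' j)) * ((k i - k' j) * (w i - w' j) - 1) := by
  simp only [pdt_expSum, pdx_expSum]
  simp only [expSum, Finset.sum_mul_sum, ← Finset.sum_add_distrib, ← Finset.sum_sub_distrib]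
  exact Finset.sum_congr rfl fun i _ => Finset.sum_congr rfl fun j _ => by ring

/-- The interaction coefficient of an opposite pair of exponentials. -/
noncomputable def pairCoeff (p q : ℝ) : ℝ := (p * q / (p + q))^2

/-- The interaction coefficient of two like exponentials `p`, `q` with an opposite one `r`. -/
noncomputable def tripleCoeff (p q r : ℝ) : ℝ :=
  (p - q)^2 * r^4 / ((p + r)^2 * (q + r)^2)

/-- The interaction coefficient of two opposite pairs of like exponentials. -/
noncomputable def quadCoeff (p q r s : ℝ) : ℝ :=
  (p - q)^2 * (r - s)^2 * (pairCoeff p r * pairCoeff q r * pairCoeff p s * pairCoeff q s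
    / (p^2 * q^2 * r^2 * s^2))

theorem tripleCoeff_swap (p q r : ℝ) : tripleCoeff p q r = tripleCoeff q p r := by
  simp only [tripleCoeff]
  ring

theorem quadCoeff_swap (p q r s : ℝ) : quadCoeff p q r s = quadCoeff q p r s := by
  simp only [quadCoeff]
  ring

theorem pairCoeff_mul_inv_add_inv_sq {p q : ℝ} (hp : p ≠ 0) (hq : q ≠ 0) (hpq : p + q ≠ 0) :
    pairCoeff p q * (p⁻¹ + q⁻¹)^2 = 1 := by
  simp only [pairCoeff]
  field_simp
  ring

theorem pairCoeff_mul_pairCoeff {p q r : ℝ} (hp : p ≠ 0) (hq : q ≠ 0)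
    (hpr : p + r ≠ 0) (hqr : q + r ≠ 0) :
    pairCoeff p r * pairCoeff q r * (p⁻¹ - q⁻¹)^2 = tripleCoeff p q r := by
  simp only [pairCoeff, tripleCoeff]
  field_simp
  ring

theorem pairCoeff_comm (p q : ℝ) : pairCoeff p q = pairCoeff q p := by
  simp only [pairCoeff, mul_comm, add_comm]

theorem mSP_cubic_coeff {p₁ p₂ p₃ : ℝ} (hp₁ : p₁ ≠ 0) (hp₂ : p₂ ≠ 0) (hp₃ : p₃ ≠ 0)
    (hp₁₃ : p₁ + p₃ ≠ 0) (hp₂₃ : p₂ + p₃ ≠ 0) :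
    pairCoeff p₁ p₃ * ((p₁ + p₃ - p₂) * (p₁⁻¹ + p₃⁻¹ - p₂⁻¹) - 1)
      + pairCoeff p₂ p₃ * ((p₂ + p₃ - p₁) * (p₂⁻¹ + p₃⁻¹ - p₁⁻¹) - 1)
      + tripleCoeff p₁ p₂ p₃
        * ((p₁ + p₂ + p₃) * (p₁⁻¹ + p₂⁻¹ + p₃⁻¹) - 1) = 0 := by
  simp only [pairCoeff, tripleCoeff]
  field_simp
  ring

theorem mSP_quintic_coeff {p₁ p₂ p₃ p₄ : ℝ}
    (hp₂ : p₂ ≠ 0) (hp₃ : p₃ ≠ 0) (hp₄ : p₄ ≠ 0)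
    (hp₁₃ : p₁ + p₃ ≠ 0) (hp₁₄ : p₁ + p₄ ≠ 0)
    (hp₂₃ : p₂ + p₃ ≠ 0) (hp₂₄ : p₂ + p₄ ≠ 0) :
    pairCoeff p₁ p₃ * tripleCoeff p₁ p₂ p₄
        * ((p₃ - p₂ - p₄) * (p₃⁻¹ - p₂⁻¹ - p₄⁻¹) - 1)
      + pairCoeff p₁ p₄ * tripleCoeff p₁ p₂ p₃
        * ((p₄ - p₂ - p₃) * (p₄⁻¹ - p₂⁻¹ - p₃⁻¹) - 1)
      + quadCoeff p₁ p₂ p₃ p₄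
        * ((p₂ + p₃ + p₄) * (p₂⁻¹ + p₃⁻¹ + p₄⁻¹) - 1) = 0 := by
  simp only [pairCoeff, tripleCoeff, quadCoeff]
  field_simp
  ring

theorem mSP_quartic_coeff {p₁ p₂ p₃ p₄ : ℝ}
    (hp₁ : p₁ ≠ 0) (hp₂ : p₂ ≠ 0) (hp₃ : p₃ ≠ 0) (hp₄ : p₄ ≠ 0)
    (hp₁₃ : p₁ + p₃ ≠ 0) (hp₁₄ : p₁ + p₄ ≠ 0)
    (hp₂₃ : p₂ + p₃ ≠ 0) (hp₂₄ : p₂ + p₄ ≠ 0) :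
    pairCoeff p₁ p₃ * pairCoeff p₂ p₄ * (p₁⁻¹ + p₃⁻¹ - p₂⁻¹ - p₄⁻¹)^2
      + pairCoeff p₁ p₄ * pairCoeff p₂ p₃ * (p₁⁻¹ + p₄⁻¹ - p₂⁻¹ - p₃⁻¹)^2
      + quadCoeff p₁ p₂ p₃ p₄ * (p₁⁻¹ + p₂⁻¹ + p₃⁻¹ + p₄⁻¹)^2
      = tripleCoeff p₁ p₂ p₃
        + tripleCoeff p₁ p₂ p₄
        + tripleCoeff p₃ p₄ p₂
        + tripleCoeff p₃ p₄ p₁ := by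
  simp only [pairCoeff, tripleCoeff, quadCoeff,
    add_comm p₃ p₁, add_comm p₃ p₂, add_comm p₄ p₁, add_comm p₄ p₂]
  field_simp
  ring

theorem mSP_xt_coeff_sum {p₁ p₂ p₃ p₄ : ℝ}
    (hp₁ : p₁ ≠ 0) (hp₂ : p₂ ≠ 0) (hp₃ : p₃ ≠ 0) (hp₄ : p₄ ≠ 0)
    (hp₁₃ : p₁ + p₃ ≠ 0) (hp₁₄ : p₁ + p₄ ≠ 0)
    (hp₂₃ : p₂ + p₃ ≠ 0) (hp₂₄ : p₂ + p₄ ≠ 0) (A₁ A₂ A₃ A₄ : ℝ)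
    {c k w : Fin 6 → ℝ} {c' k' w' : Fin 4 → ℝ}
    (hc : c = ![1, A₁ * A₃ * pairCoeff p₁ p₃, A₂ * A₃ * pairCoeff p₂ p₃,
      A₁ * A₄ * pairCoeff p₁ p₄, A₂ * A₄ * pairCoeff p₂ p₄,
      A₁ * A₂ * A₃ * A₄ * quadCoeff p₁ p₂ p₃ p₄])
    (hk : k = ![0, p₁ + p₃, p₂ + p₃, p₁ + p₄, p₂ + p₄, p₁ + p₂ + p₃ + p₄])
    (hw : w = ![0, p₁⁻¹ + p₃⁻¹, p₂⁻¹ + p₃⁻¹, p₁⁻¹ + p₄⁻¹, p₂⁻¹ + p₄⁻¹,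
      p₁⁻¹ + p₂⁻¹ + p₃⁻¹ + p₄⁻¹])
    (hc' : c' = ![A₁, A₂,
      A₁ * A₂ * A₃ * tripleCoeff p₁ p₂ p₃,
      A₁ * A₂ * A₄ * tripleCoeff p₁ p₂ p₄])
    (hk' : k' = ![p₁, p₂, p₁ + p₂ + p₃, p₁ + p₂ + p₄])
    (hw' : w' = ![p₁⁻¹, p₂⁻¹, p₁⁻¹ + p₂⁻¹ + p₃⁻¹, p₁⁻¹ + p₂⁻¹ + p₄⁻¹]) :
    ∑ i, ∑ j, c i * c' j * ((k i - k' j) * (w i - w' j) - 1) = 0 := by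
  have hI₃ := mSP_cubic_coeff hp₁ hp₂ hp₃ hp₁₃ hp₂₃
  have hI₄ := mSP_cubic_coeff hp₁ hp₂ hp₄ hp₁₄ hp₂₄
  have hJ₁ := mSP_quintic_coeff hp₂ hp₃ hp₄ hp₁₃ hp₁₄ hp₂₃ hp₂₄
  have hJ₂ := mSP_quintic_coeff hp₁ hp₃ hp₄ hp₂₃ hp₂₄ hp₁₃ hp₁₄
  rw [quadCoeff_swap p₂, tripleCoeff_swap p₂, tripleCoeff_swap p₂] at hJ₂
  have h₁ := mul_inv_cancel₀ hp₁
  have h₂ := mul_inv_cancel₀ hp₂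
  have h₃ := mul_inv_cancel₀ hp₃
  have h₄ := mul_inv_cancel₀ hp₄
  subst hk hw hk' hw'
  generalize quadCoeff p₁ p₂ p₃ p₄ = C at *
  generalize tripleCoeff p₁ p₂ p₃ = D₃ at *
  generalize tripleCoeff p₁ p₂ p₄ = D₄ at *
  generalize pairCoeff p₁ p₃ = b₁₃ at *
  generalize pairCoeff p₂ p₃ = b₂₃ at *
  generalize pairCoeff p₁ p₄ = b₁₄ at *
  generalize pairCoeff p₂ p₄ = b₂₄ at *
  subst hc hc'
  generalize p₁⁻¹ = q₁ at *
  generalize p₂⁻¹ = q₂ at *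
  generalize p₃⁻¹ = q₃ at *
  generalize p₄⁻¹ = q₄ at *
  simp only [Fin.sum_univ_six, Fin.sum_univ_four, Matrix.cons_val]
  linear_combination A₁ * A₂ * A₃ * hI₃ + A₁ * A₂ * A₄ * hI₄
    + A₁ * (A₁ * A₂ * A₃ * A₄) * hJ₁ + A₂ * (A₁ * A₂ * A₃ * A₄) * hJ₂
    + (A₁ + A₂ * A₃ * b₂₃ * (A₁ * A₂ * A₃ * D₃) + A₂ * A₄ * b₂₄ * (A₁ * A₂ * A₄ * D₄)) * h₁
    + (A₂ + A₁ * A₃ * b₁₃ * (A₁ * A₂ * A₃ * D₃) + A₁ * A₄ * b₁₄ * (A₁ * A₂ * A₄ * D₄)) * h₂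
    + (A₁ * A₃ * b₁₃ * A₁ + A₂ * A₃ * b₂₃ * A₂
      + A₁ * A₂ * A₃ * A₄ * C * (A₁ * A₂ * A₄ * D₄)) * h₃
    + (A₁ * A₄ * b₁₄ * A₁ + A₂ * A₄ * b₂₄ * A₂
      + A₁ * A₂ * A₃ * A₄ * C * (A₁ * A₂ * A₃ * D₃)) * h₄

/-- The even two-soliton tau function. -/
noncomputable def tauEven (p₁ p₂ p₃ p₄ a₁ a₂ a₃ a₄ ξ₁ ξ₂ ξ₃ ξ₄ : ℝ) : ℝ → ℝ → ℝ :=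
  expSum
    ![1, a₁ * a₃ * pairCoeff p₁ p₃, a₂ * a₃ * pairCoeff p₂ p₃,
      a₁ * a₄ * pairCoeff p₁ p₄, a₂ * a₄ * pairCoeff p₂ p₄,
      a₁ * a₂ * a₃ * a₄ * quadCoeff p₁ p₂ p₃ p₄]
    ![0, p₁ + p₃, p₂ + p₃, p₁ + p₄, p₂ + p₄, p₁ + p₂ + p₃ + p₄]
    ![0, p₁⁻¹ + p₃⁻¹, p₂⁻¹ + p₃⁻¹, p₁⁻¹ + p₄⁻¹, p₂⁻¹ + p₄⁻¹, p₁⁻¹ + p₂⁻¹ + p₃⁻¹ + p₄⁻¹]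
    ![0, ξ₁ + ξ₃, ξ₂ + ξ₃, ξ₁ + ξ₄, ξ₂ + ξ₄, ξ₁ + ξ₂ + ξ₃ + ξ₄]

/-- The odd two-soliton tau function. -/
noncomputable def tauOdd (p₁ p₂ p₃ p₄ a₁ a₂ a₃ a₄ ξ₁ ξ₂ ξ₃ ξ₄ : ℝ) : ℝ → ℝ → ℝ :=
  expSum
    ![a₁, a₂, a₁ * a₂ * a₃ * tripleCoeff p₁ p₂ p₃,
      a₁ * a₂ * a₄ * tripleCoeff p₁ p₂ p₄]
    ![p₁, p₂, p₁ + p₂ + p₃, p₁ + p₂ + p₄]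
    ![p₁⁻¹, p₂⁻¹, p₁⁻¹ + p₂⁻¹ + p₃⁻¹, p₁⁻¹ + p₂⁻¹ + p₄⁻¹]
    ![ξ₁, ξ₂, ξ₁ + ξ₂ + ξ₃, ξ₁ + ξ₂ + ξ₄]

theorem tauEven_swap (p₁ p₂ p₃ p₄ a₁ a₂ a₃ a₄ ξ₁ ξ₂ ξ₃ ξ₄ : ℝ) :
    tauEven p₃ p₄ p₁ p₂ a₃ a₄ a₁ a₂ ξ₃ ξ₄ ξ₁ ξ₂ = tauEven p₁ p₂ p₃ p₄ a₁ a₂ a₃ a₄ ξ₁ ξ₂ ξ₃ ξ₄ := by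
  funext x t
  simp only [tauEven, expSum, pairCoeff, quadCoeff, Fin.sum_univ_six, Matrix.cons_val, add_mul, Real.exp_add]
  ring

theorem tauEven_tauOdd_xt {p₁ p₂ p₃ p₄ : ℝ}
    (hp₁ : p₁ ≠ 0) (hp₂ : p₂ ≠ 0) (hp₃ : p₃ ≠ 0) (hp₄ : p₄ ≠ 0)
    (hp₁₃ : p₁ + p₃ ≠ 0) (hp₁₄ : p₁ + p₄ ≠ 0)
    (hp₂₃ : p₂ + p₃ ≠ 0) (hp₂₄ : p₂ + p₄ ≠ 0) (a₁ a₂ a₃ a₄ ξ₁ ξ₂ ξ₃ ξ₄ : ℝ)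
    {f g : ℝ → ℝ → ℝ} (hf : f = tauEven p₁ p₂ p₃ p₄ a₁ a₂ a₃ a₄ ξ₁ ξ₂ ξ₃ ξ₄)
    (hg : g = tauOdd p₁ p₂ p₃ p₄ a₁ a₂ a₃ a₄ ξ₁ ξ₂ ξ₃ ξ₄) (x t : ℝ) :
    pdx (pdt f) x t * g x t - pdx f x t * pdt g x t
      - pdt f x t * pdx g x t + f x t * pdx (pdt g) x t = f x t * g x t := by
  rw [← sub_eq_zero, hf, hg, tauEven, tauOdd, hirota_xt_expSum]
  refine mSP_xt_coeff_sum hp₁ hp₂ hp₃ hp₄ hp₁₃ hp₁₄ hp₂₃ hp₂₄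
    (a₁ * Real.exp (p₁ * x + p₁⁻¹ * t + ξ₁)) (a₂ * Real.exp (p₂ * x + p₂⁻¹ * t + ξ₂))
    (a₃ * Real.exp (p₃ * x + p₃⁻¹ * t + ξ₃)) (a₄ * Real.exp (p₄ * x + p₄⁻¹ * t + ξ₄))
    ?_ rfl rfl ?_ rfl rfl
  · funext i
    fin_cases i <;> simp [add_mul, Real.exp_add] <;> ring
  · funext i
    fin_cases i <;> simp [add_mul, Real.exp_add] <;> ring

theorem tauEven_tt {p₁ p₂ p₃ p₄ : ℝ}
    (hp₁ : p₁ ≠ 0) (hp₂ : p₂ ≠ 0) (hp₃ : p₃ ≠ 0) (hp₄ : p₄ ≠ 0)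
    (hp₁₃ : p₁ + p₃ ≠ 0) (hp₁₄ : p₁ + p₄ ≠ 0)
    (hp₂₃ : p₂ + p₃ ≠ 0) (hp₂₄ : p₂ + p₄ ≠ 0) (a₁ a₂ a₃ a₄ ξ₁ ξ₂ ξ₃ ξ₄ : ℝ)
    {f g₁ g₂ : ℝ → ℝ → ℝ} (hf : f = tauEven p₁ p₂ p₃ p₄ a₁ a₂ a₃ a₄ ξ₁ ξ₂ ξ₃ ξ₄)
    (hg₁ : g₁ = tauOdd p₁ p₂ p₃ p₄ a₁ a₂ a₃ a₄ ξ₁ ξ₂ ξ₃ ξ₄)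
    (hg₂ : g₂ = tauOdd p₃ p₄ p₁ p₂ a₃ a₄ a₁ a₂ ξ₃ ξ₄ ξ₁ ξ₂) (x t : ℝ) :
    pdt (pdt f) x t * f x t - (pdt f x t)^2 = g₁ x t * g₂ x t := by
  have hK := mSP_quartic_coeff hp₁ hp₂ hp₃ hp₄ hp₁₃ hp₁₄ hp₂₃ hp₂₄
  have hb₁₃ := pairCoeff_mul_inv_add_inv_sq hp₁ hp₃ hp₁₃
  have hb₁₄ := pairCoeff_mul_inv_add_inv_sq hp₁ hp₄ hp₁₄
  have hb₂₃ := pairCoeff_mul_inv_add_inv_sq hp₂ hp₃ hp₂₃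
  have hb₂₄ := pairCoeff_mul_inv_add_inv_sq hp₂ hp₄ hp₂₄
  have hD₃ := pairCoeff_mul_pairCoeff hp₁ hp₂ hp₁₃ hp₂₃
  have hD₄ := pairCoeff_mul_pairCoeff hp₁ hp₂ hp₁₄ hp₂₄
  have hG₁ : pairCoeff p₁ p₃ * pairCoeff p₁ p₄ * (p₃⁻¹ - p₄⁻¹)^2 = tripleCoeff p₃ p₄ p₁ := by
    rw [pairCoeff_comm p₁ p₃, pairCoeff_comm p₁ p₄]
    exact pairCoeff_mul_pairCoeff hp₃ hp₄ (by rwa [add_comm]) (by rwa [add_comm])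
  have hG₂ : pairCoeff p₂ p₃ * pairCoeff p₂ p₄ * (p₃⁻¹ - p₄⁻¹)^2 = tripleCoeff p₃ p₄ p₂ := by
    rw [pairCoeff_comm p₂ p₃, pairCoeff_comm p₂ p₄]
    exact pairCoeff_mul_pairCoeff hp₃ hp₄ (by rwa [add_comm]) (by rwa [add_comm])
  have hC : quadCoeff p₁ p₂ p₃ p₄ = pairCoeff p₁ p₃ * pairCoeff p₂ p₃ * pairCoeff p₁ p₄
      * pairCoeff p₂ p₄ * (p₁⁻¹ - p₂⁻¹)^2 * (p₃⁻¹ - p₄⁻¹)^2 := by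
    simp only [quadCoeff]
    field_simp
    ring
  rw [hf, hg₁, hg₂]
  simp only [tauEven, tauOdd, pdt_expSum]
  simp only [expSum, Fin.sum_univ_six, Fin.sum_univ_four, Matrix.cons_val, add_mul,
    Real.exp_add, zero_mul, Real.exp_zero]
  clear hf hg₁ hg₂
  generalize quadCoeff p₁ p₂ p₃ p₄ = C at *
  generalize tripleCoeff p₁ p₂ p₃ = D₃ at *
  generalize tripleCoeff p₁ p₂ p₄ = D₄ at *
  generalize tripleCoeff p₃ p₄ p₁ = G₁ at *
  generalize tripleCoeff p₃ p₄ p₂ = G₂ at *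
  generalize pairCoeff p₁ p₃ = b₁₃ at *
  generalize pairCoeff p₁ p₄ = b₁₄ at *
  generalize pairCoeff p₂ p₃ = b₂₃ at *
  generalize pairCoeff p₂ p₄ = b₂₄ at *
  generalize p₁⁻¹ = q₁ at *
  generalize p₂⁻¹ = q₂ at *
  generalize p₃⁻¹ = q₃ at *
  generalize p₄⁻¹ = q₄ at *
  subst hC hD₃ hD₄ hG₁ hG₂
  let A₁ := a₁ * (Real.exp (p₁ * x) * Real.exp (q₁ * t) * Real.exp ξ₁)
  let A₂ := a₂ * (Real.exp (p₂ * x) * Real.exp (q₂ * t) * Real.exp ξ₂)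
  let A₃ := a₃ * (Real.exp (p₃ * x) * Real.exp (q₃ * t) * Real.exp ξ₃)
  let A₄ := a₄ * (Real.exp (p₄ * x) * Real.exp (q₄ * t) * Real.exp ξ₄)
  linear_combination A₁ * A₃ * hb₁₃
    + A₁ * A₄ * hb₁₄
    + A₂ * A₃ * hb₂₃
    + A₂ * A₄ * hb₂₄
    + A₁ * A₂ * A₃ * A₄ * A₁ * A₃ * (b₁₃^2 * b₁₄ * b₂₃ * (q₁ - q₂)^2 * (q₃ - q₄)^2) * hb₂₄
    + A₁ * A₂ * A₃ * A₄ * A₁ * A₄ * (b₁₄^2 * b₁₃ * b₂₄ * (q₁ - q₂)^2 * (q₃ - q₄)^2) * hb₂₃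
    + A₁ * A₂ * A₃ * A₄ * A₂ * A₃ * (b₂₃^2 * b₂₄ * b₁₃ * (q₁ - q₂)^2 * (q₃ - q₄)^2) * hb₁₄
    + A₁ * A₂ * A₃ * A₄ * A₂ * A₄ * (b₂₄^2 * b₂₃ * b₁₄ * (q₁ - q₂)^2 * (q₃ - q₄)^2) * hb₁₃
    + A₁ * A₂ * A₃ * A₄ * hK

/-- the two-soliton tau functions satisfy the bilinear form of the
    2-component modified short pulse equation. -/
theorem twoComponent_mSP_two_soliton (p₁ p₂ p₃ p₄ : ℝ)
    (hp₁ : p₁ ≠ 0) (hp₂ : p₂ ≠ 0) (hp₃ : p₃ ≠ 0) (hp₄ : p₄ ≠ 0)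
    (hp₁₃ : p₁ + p₃ ≠ 0) (hp₁₄ : p₁ + p₄ ≠ 0)
    (hp₂₃ : p₂ + p₃ ≠ 0) (hp₂₄ : p₂ + p₄ ≠ 0)
    (a₁ a₂ a₃ a₄ ξ₁ ξ₂ ξ₃ ξ₄ : ℝ)
    (b₁₃ b₂₃ b₁₄ b₂₄ : ℝ)
    (hb₁₃ : b₁₃ = (p₁ * p₃ / (p₁ + p₃))^2)
    (hb₂₃ : b₂₃ = (p₂ * p₃ / (p₂ + p₃))^2)
    (hb₁₄ : b₁₄ = (p₁ * p₄ / (p₁ + p₄))^2)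
    (hb₂₄ : b₂₄ = (p₂ * p₄ / (p₂ + p₄))^2)
    (η₁ η₂ η₃ η₄ : ℝ → ℝ → ℝ)
    (hη₁ : ∀ X T, η₁ X T = p₁ * X + T / p₁ + ξ₁)
    (hη₂ : ∀ X T, η₂ X T = p₂ * X + T / p₂ + ξ₂)
    (hη₃ : ∀ X T, η₃ X T = p₃ * X + T / p₃ + ξ₃)
    (hη₄ : ∀ X T, η₄ X T = p₄ * X + T / p₄ + ξ₄)
    (f g₁ g₂ : ℝ → ℝ → ℝ)
    (hf : ∀ X T, f X T =
      1 + a₁ * a₃ * b₁₃ * Real.exp (η₁ X T + η₃ X T)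
        + a₂ * a₃ * b₂₃ * Real.exp (η₂ X T + η₃ X T)
        + a₁ * a₄ * b₁₄ * Real.exp (η₁ X T + η₄ X T)
        + a₂ * a₄ * b₂₄ * Real.exp (η₂ X T + η₄ X T)
        + a₁ * a₂ * a₃ * a₄ * (p₁ - p₂)^2 * (p₃ - p₄)^2
            * (b₁₃ * b₂₃ * b₁₄ * b₂₄ / (p₁^2 * p₂^2 * p₃^2 * p₄^2))
            * Real.exp (η₁ X T + η₂ X T + η₃ X T + η₄ X T))
    (hg₁ : ∀ X T, g₁ X T =
      a₁ * Real.exp (η₁ X T) + a₂ * Real.exp (η₂ X T)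
        + a₁ * a₂ * a₃ * (p₁ - p₂)^2 * p₃^4 / ((p₁ + p₃)^2 * (p₂ + p₃)^2)
            * Real.exp (η₁ X T + η₂ X T + η₃ X T)
        + a₁ * a₂ * a₄ * (p₁ - p₂)^2 * p₄^4 / ((p₁ + p₄)^2 * (p₂ + p₄)^2)
            * Real.exp (η₁ X T + η₂ X T + η₄ X T))
    (hg₂ : ∀ X T, g₂ X T =
      a₃ * Real.exp (η₃ X T) + a₄ * Real.exp (η₄ X T)
        + a₂ * a₃ * a₄ * (p₃ - p₄)^2 * p₂^4 / ((p₂ + p₃)^2 * (p₂ + p₄)^2)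
            * Real.exp (η₂ X T + η₃ X T + η₄ X T)
        + a₁ * a₃ * a₄ * (p₃ - p₄)^2 * p₁^4 / ((p₁ + p₃)^2 * (p₁ + p₄)^2)
            * Real.exp (η₁ X T + η₃ X T + η₄ X T)) :
    (∀ X T,
      pdx (pdt f) X T * g₁ X T - pdx f X T * pdt g₁ X T
        - pdt f X T * pdx g₁ X T + f X T * pdx (pdt g₁) X T
        = f X T * g₁ X T) ∧
    (∀ X T,
      pdx (pdt f) X T * g₂ X T - pdx f X T * pdt g₂ X T
        - pdt f X T * pdx g₂ X T + f X T * pdx (pdt g₂) X T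
        = f X T * g₂ X T) ∧
    (∀ X T,
      pdt (pdt f) X T * f X T - (pdt f X T)^2 = g₁ X T * g₂ X T) := by
  have hf' : f = tauEven p₁ p₂ p₃ p₄ a₁ a₂ a₃ a₄ ξ₁ ξ₂ ξ₃ ξ₄ := by
    funext x t
    simp only [hf, hη₁, hη₂, hη₃, hη₄, hb₁₃, hb₂₃, hb₁₄, hb₂₄, tauEven, expSum, pairCoeff, quadCoeff,
      Fin.sum_univ_six, Matrix.cons_val, add_mul, Real.exp_add, zero_mul, Real.exp_zero,
      div_eq_inv_mul t]
    ring
  have hg₁' : g₁ = tauOdd p₁ p₂ p₃ p₄ a₁ a₂ a₃ a₄ ξ₁ ξ₂ ξ₃ ξ₄ := by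
    funext x t
    simp only [hg₁, hη₁, hη₂, hη₃, hη₄, tauOdd, expSum, tripleCoeff,
      Fin.sum_univ_four, Matrix.cons_val, add_mul, Real.exp_add, div_eq_inv_mul t]
    ring
  have hg₂' : g₂ = tauOdd p₃ p₄ p₁ p₂ a₃ a₄ a₁ a₂ ξ₃ ξ₄ ξ₁ ξ₂ := by
    funext x t
    simp only [hg₂, hη₁, hη₂, hη₃, hη₄, tauOdd, expSum, tripleCoeff,
      Fin.sum_univ_four, Matrix.cons_val, add_mul, Real.exp_add, div_eq_inv_mul t]
    ring
  refine ⟨tauEven_tauOdd_xt hp₁ hp₂ hp₃ hp₄ hp₁₃ hp₁₄ hp₂₃ hp₂₄ a₁ a₂ a₃ a₄ ξ₁ ξ₂ ξ₃ ξ₄ hf' hg₁',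
    tauEven_tauOdd_xt hp₃ hp₄ hp₁ hp₂ ?_ ?_ ?_ ?_ a₃ a₄ a₁ a₂ ξ₃ ξ₄ ξ₁ ξ₂
      (hf'.trans (tauEven_swap ..).symm) hg₂',
    tauEven_tt hp₁ hp₂ hp₃ hp₄ hp₁₃ hp₁₄ hp₂₃ hp₂₄ a₁ a₂ a₃ a₄ ξ₁ ξ₂ ξ₃ ξ₄ hf' hg₁' hg₂'⟩ <;>
  rwa [add_comm]
end

section
/- Let p_1, p_2 be nonzero reals with p_1 + p_2 ≠ 0, and let a_1, a_2, ξ_1, ξ_2 ∈ ℝ. Set b_{12} = (p_1 p_2/(p_1+p_2))² and η_j(X,T) = p_j X + T/p_j + ξ_j. Define f := −1 − (a_1 a_2 b_{12}/4) e^{η_1+η_2}, g^{(1)} := −a_1 e^{η_1}, g^{(2)} := −a_2 e^{η_2}. Then f, g^{(1)}, g^{(2)} satisfy the bilinear form of the 2-component short pulse equation: f_{XT} g^{(i)} − f_X g^{(i)}_T − f_T g^{(i)}_X + f g^{(i)}_{XT} = f·g^{(i)} for i = 1,2, and f_{TT} f − (f_T)² = (1/4) g^{(1)} g^{(2)}.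 -/
/-- The `x`-derivative of a constant plus an exponential of an affine function. -/
theorem pdx_add_mul_exp (A B p q r : ℝ) :
    pdx (fun X T => A + B * Real.exp (p * X + q * T + r)) =
      fun X T => 0 + B * p * Real.exp (p * X + q * T + r) := by
  funext X T
  have h : HasDerivAt (fun y : ℝ => p * y + q * T + r) (p * 1) X :=
    (((hasDerivAt_id' X).const_mul p).add_const _).add_const _
  rw [pdx, ((h.exp.const_mul B).const_add A).deriv]
  ring

/-- The `t`-derivative of a constant plus an exponential of an affine function. -/
theorem pdt_add_mul_exp (A B p q r : ℝ) :
    pdt (fun X T => A + B * Real.exp (p * X + q * T + r)) =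
      fun X T => 0 + B * q * Real.exp (p * X + q * T + r) := by
  funext X T
  have h : HasDerivAt (fun s : ℝ => p * X + q * s + r) (q * 1) T :=
    (((hasDerivAt_id' T).const_mul q).const_add _).add_const _
  rw [pdt, ((h.exp.const_mul B).const_add A).deriv]
  ring

/-- the one-soliton tau functions satisfy the bilinear form of the
    2-component short pulse equation. -/
theorem twoComponent_SP_one_soliton (p₁ p₂ : ℝ)
    (hp₁ : p₁ ≠ 0) (hp₂ : p₂ ≠ 0) (hp : p₁ + p₂ ≠ 0)
    (a₁ a₂ ξ₁ ξ₂ : ℝ)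
    (b₁₂ : ℝ) (hb : b₁₂ = (p₁ * p₂ / (p₁ + p₂))^2)
    (η₁ η₂ : ℝ → ℝ → ℝ)
    (hη₁ : ∀ X T, η₁ X T = p₁ * X + T / p₁ + ξ₁)
    (hη₂ : ∀ X T, η₂ X T = p₂ * X + T / p₂ + ξ₂)
    (f g₁ g₂ : ℝ → ℝ → ℝ)
    (hf : ∀ X T, f X T = -1 - a₁ * a₂ * b₁₂ / 4 * Real.exp (η₁ X T + η₂ X T))
    (hg₁ : ∀ X T, g₁ X T = -a₁ * Real.exp (η₁ X T))
    (hg₂ : ∀ X T, g₂ X T = -a₂ * Real.exp (η₂ X T)) :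
    (∀ X T,
      pdx (pdt f) X T * g₁ X T - pdx f X T * pdt g₁ X T
        - pdt f X T * pdx g₁ X T + f X T * pdx (pdt g₁) X T
        = f X T * g₁ X T) ∧
    (∀ X T,
      pdx (pdt f) X T * g₂ X T - pdx f X T * pdt g₂ X T
        - pdt f X T * pdx g₂ X T + f X T * pdx (pdt g₂) X T
        = f X T * g₂ X T) ∧
    (∀ X T,
      pdt (pdt f) X T * f X T - (pdt f X T)^2 = (1/4) * (g₁ X T * g₂ X T)) := by
  have hf' : f = fun X T => -1 + -(a₁ * a₂ * b₁₂ / 4) *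
      Real.exp ((p₁ + p₂) * X + (1 / p₁ + 1 / p₂) * T + (ξ₁ + ξ₂)) := by
    funext X T
    rw [hf, hη₁, hη₂, show p₁ * X + T / p₁ + ξ₁ + (p₂ * X + T / p₂ + ξ₂) =
      (p₁ + p₂) * X + (1 / p₁ + 1 / p₂) * T + (ξ₁ + ξ₂) by ring]
    ring
  have hg₁' : g₁ = fun X T => 0 + -a₁ * Real.exp (p₁ * X + 1 / p₁ * T + ξ₁) := by
    funext X T
    rw [hg₁, hη₁, show p₁ * X + T / p₁ + ξ₁ = p₁ * X + 1 / p₁ * T + ξ₁ by ring, zero_add]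
  have hg₂' : g₂ = fun X T => 0 + -a₂ * Real.exp (p₂ * X + 1 / p₂ * T + ξ₂) := by
    funext X T
    rw [hg₂, hη₂, show p₂ * X + T / p₂ + ξ₂ = p₂ * X + 1 / p₂ * T + ξ₂ by ring, zero_add]
  have hexp (X T : ℝ) : Real.exp ((p₁ + p₂) * X + (1 / p₁ + 1 / p₂) * T + (ξ₁ + ξ₂)) =
      Real.exp (p₁ * X + 1 / p₁ * T + ξ₁) * Real.exp (p₂ * X + 1 / p₂ * T + ξ₂) := by
    rw [← Real.exp_add]
    congr 1
    ring
  refine ⟨fun X T => ?_, fun X T => ?_, fun X T => ?_⟩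
  · simp only [hf', hg₁', pdt_add_mul_exp, pdx_add_mul_exp]
    generalize Real.exp _ = E
    generalize Real.exp _ = G
    field_simp
    ring
  · simp only [hf', hg₂', pdt_add_mul_exp, pdx_add_mul_exp]
    generalize Real.exp _ = E
    generalize Real.exp _ = G
    field_simp
    ring
  · simp only [hf', hg₁', hg₂', pdt_add_mul_exp]
    rw [hexp, hb]
    generalize Real.exp _ = E
    generalize Real.exp _ = G
    field_simp
    ring
end

section
/- Let a ≠ 0 and p_1, p_2 be nonzero reals with p_1 + p_2 ≠ 0, 1 − a p_j ≠ 0 and 1 + a p_j ≠ 0 for j = 1,2, and let a_1, a_2, ξ_1, ξ_2 ∈ ℝ. Set b_{12} = (p_1 p_2/(p_1+p_2))² and, for l ∈ ℤ and T ∈ ℝ, ψ_j(l,T) := ((1 + a p_j)/(1 − a p_j))^l · e^{T/p_j + ξ_j}. Define f_l(T) := −1 − a_1 a_2 b_{12} ψ_1(l,T) ψ_2(l,T), g_l^{(1)}(T) := −a_1 ψ_1(l,T), g_l^{(2)}(T) := −a_2 ψ_2(l,T). Then for all l ∈ ℤ and i = 1,2: (1/a)·[ (g_{l+1}^{(i)})'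 f_l − g_{l+1}^{(i)} f_l' − (g_l^{(i)})' f_{l+1} + g_l^{(i)} f_{l+1}' ] = g_{l+1}^{(i)} f_l + g_l^{(i)} f_{l+1}, and f_l'' f_l − (f_l')² = g_l^{(1)} g_l^{(2)}, where a prime denotes d/dT. -/
/-- The part of the semi-discrete bilinear equation that involves one component, after the
derivatives have been computed: `x`, `y` are the values of the two exponentials at the site `l`,
and `c`, `d` their growth factors from `l` to `l + 1`. -/
theorem semidiscrete_bilinear_algebra {a p q c d : ℝ} (ha : a ≠ 0) (hp : p ≠ 0) (hq : q ≠ 0)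
    (hc : c * (1 - a * p) = 1 + a * p) (hd : d * (1 - a * q) = 1 + a * q) (A B x y : ℝ) :
    (1 / a) * (-A * (c * x / p) * (-1 - B * x * y)
        - -A * (c * x) * (-(B * (1 / p + 1 / q) * x * y))
        - -A * (x / p) * (-1 - B * (c * x) * (d * y))
        + -A * x * (-(B * (1 / p + 1 / q) * (c * x) * (d * y))))
      = -A * (c * x) * (-1 - B * x * y) + -A * x * (-1 - B * (c * x) * (d * y)) := by
  field_simp
  linear_combination A * x * q * hc + A * B * x ^ 2 * y * c * p * hd


/-- the one-soliton tau functions satisfy the semi-discrete bilinear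
    form of the 2-component modified short pulse equation. -/
theorem semidiscrete_twoComponent_mSP_one_soliton (a p₁ p₂ : ℝ)
    (ha : a ≠ 0) (hp₁ : p₁ ≠ 0) (hp₂ : p₂ ≠ 0) (hp : p₁ + p₂ ≠ 0)
    (h₁m : 1 - a * p₁ ≠ 0) (h₂m : 1 - a * p₂ ≠ 0)
    (h₁p : 1 + a * p₁ ≠ 0) (h₂p : 1 + a * p₂ ≠ 0)
    (a₁ a₂ ξ₁ ξ₂ : ℝ)
    (b₁₂ : ℝ) (hb : b₁₂ = (p₁ * p₂ / (p₁ + p₂))^2)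
    (ψ₁ ψ₂ : ℤ → ℝ → ℝ)
    (hψ₁ : ∀ (l : ℤ) (T : ℝ),
      ψ₁ l T = ((1 + a * p₁) / (1 - a * p₁)) ^ l * Real.exp (T / p₁ + ξ₁))
    (hψ₂ : ∀ (l : ℤ) (T : ℝ),
      ψ₂ l T = ((1 + a * p₂) / (1 - a * p₂)) ^ l * Real.exp (T / p₂ + ξ₂))
    (f g₁ g₂ : ℤ → ℝ → ℝ)
    (hf : ∀ (l : ℤ) (T : ℝ), f l T = -1 - a₁ * a₂ * b₁₂ * ψ₁ l T * ψ₂ l T)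
    (hg₁ : ∀ (l : ℤ) (T : ℝ), g₁ l T = -a₁ * ψ₁ l T)
    (hg₂ : ∀ (l : ℤ) (T : ℝ), g₂ l T = -a₂ * ψ₂ l T) :
    (∀ (l : ℤ) (T : ℝ),
      (1/a) * (deriv (g₁ (l+1)) T * f l T - g₁ (l+1) T * deriv (f l) T
        - deriv (g₁ l) T * f (l+1) T + g₁ l T * deriv (f (l+1)) T)
        = g₁ (l+1) T * f l T + g₁ l T * f (l+1) T) ∧
    (∀ (l : ℤ) (T : ℝ),
      (1/a) * (deriv (g₂ (l+1)) T * f l T - g₂ (l+1) T * deriv (f l) T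
        - deriv (g₂ l) T * f (l+1) T + g₂ l T * deriv (f (l+1)) T)
        = g₂ (l+1) T * f l T + g₂ l T * f (l+1) T) ∧
    (∀ (l : ℤ) (T : ℝ),
      deriv (deriv (f l)) T * f l T - (deriv (f l) T)^2 = g₁ l T * g₂ l T) := by
  have hc₁ : (1 + a * p₁) / (1 - a * p₁) * (1 - a * p₁) = 1 + a * p₁ := div_mul_cancel₀ _ h₁m
  have hc₂ : (1 + a * p₂) / (1 - a * p₂) * (1 - a * p₂) = 1 + a * p₂ := div_mul_cancel₀ _ h₂m
  have shift₁ (l : ℤ) (T : ℝ) : ψ₁ (l + 1) T = (1 + a * p₁) / (1 - a * p₁) * ψ₁ l T := by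
    rw [hψ₁, hψ₁, zpow_add_one₀ (div_ne_zero h₁p h₁m)]; ring
  have shift₂ (l : ℤ) (T : ℝ) : ψ₂ (l + 1) T = (1 + a * p₂) / (1 - a * p₂) * ψ₂ l T := by
    rw [hψ₂, hψ₂, zpow_add_one₀ (div_ne_zero h₂p h₂m)]; ring
  have dψ₁ (l : ℤ) (T : ℝ) : HasDerivAt (ψ₁ l) (ψ₁ l T / p₁) T := by
    rw [funext (hψ₁ l)]
    exact ((((hasDerivAt_id T).div_const p₁).add_const ξ₁).exp.const_mul _).congr_deriv
      (by simp only [id]; ring)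
  have dψ₂ (l : ℤ) (T : ℝ) : HasDerivAt (ψ₂ l) (ψ₂ l T / p₂) T := by
    rw [funext (hψ₂ l)]
    exact ((((hasDerivAt_id T).div_const p₂).add_const ξ₂).exp.const_mul _).congr_deriv
      (by simp only [id]; ring)
  have dprod (K : ℝ) (l : ℤ) (T : ℝ) : HasDerivAt (fun T => K * ψ₁ l T * ψ₂ l T)
      (K * (1 / p₁ + 1 / p₂) * ψ₁ l T * ψ₂ l T) T := by
    exact (((dψ₁ l T).const_mul K).mul (dψ₂ l T)).congr_deriv (by ring)
  have df (l : ℤ) : deriv (f l) = fun T =>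
      -(a₁ * a₂ * b₁₂ * (1 / p₁ + 1 / p₂) * ψ₁ l T * ψ₂ l T) := by
    ext T
    rw [funext (hf l)]
    exact ((dprod _ l T).const_sub (-1)).deriv
  have ddf (l : ℤ) (T : ℝ) : deriv (deriv (f l)) T =
      -(a₁ * a₂ * b₁₂ * (1 / p₁ + 1 / p₂) * (1 / p₁ + 1 / p₂) * ψ₁ l T * ψ₂ l T) := by
    rw [df]
    exact (dprod _ l T).neg.deriv
  have dg₁ (l : ℤ) (T : ℝ) : deriv (g₁ l) T = -a₁ * (ψ₁ l T / p₁) := by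
    rw [funext (hg₁ l)]
    exact ((dψ₁ l T).const_mul _).deriv
  have dg₂ (l : ℤ) (T : ℝ) : deriv (g₂ l) T = -a₂ * (ψ₂ l T / p₂) := by
    rw [funext (hg₂ l)]
    exact ((dψ₂ l T).const_mul _).deriv
  refine ⟨fun l T => ?_, fun l T => ?_, fun l T => ?_⟩
  · simp only [dg₁, df, hf, hg₁, shift₁, shift₂]
    exact semidiscrete_bilinear_algebra ha hp₁ hp₂ hc₁ hc₂ a₁ (a₁ * a₂ * b₁₂) (ψ₁ l T) (ψ₂ l T)
  · simp only [dg₂, df, hf, hg₂, shift₁, shift₂]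
    linear_combination
      semidiscrete_bilinear_algebra ha hp₂ hp₁ hc₂ hc₁ a₂ (a₁ * a₂ * b₁₂) (ψ₂ l T) (ψ₁ l T)
  · have hb' : b₁₂ * (1 / p₁ + 1 / p₂) ^ 2 = 1 := by
      rw [hb]
      field_simp
      ring
    rw [ddf, df, hf, hg₁, hg₂]
    linear_combination a₁ * a₂ * ψ₁ l T * ψ₂ l T * hb'
end

section
/- Let a ≠ 0 and p_1, p_2 be nonzero reals with p_1 + p_2 ≠ 0, 1 − a p_j ≠ 0 and 1 + a p_j ≠ 0 for j = 1,2, and let a_1, a_2, ξ_1, ξ_2 ∈ ℝ. Set b_{12} = (p_1 p_2/(p_1+p_2))² and, for l ∈ ℤ and T ∈ ℝ, ψ_j(l,T) := ((1 + a p_j)/(1 − a p_j))^l · e^{T/p_j + ξ_j}. Define f_l(T) := −1 − (a_1 a_2 b_{12}/4) ψ_1(l,T) ψ_2(l,T), g_l^{(1)}(T) := −a_1 ψ_1(l,T), g_l^{(2)}(T) := −a_2 ψ_2(l,T). Then for all l ∈ ℤ and i = 1,2: (1/a)·[ (g_{l+1}^{(i)})' f_l − g_{l+1}^{(i)} f_l'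 − (g_l^{(i)})' f_{l+1} + g_l^{(i)} f_{l+1}' ] = g_{l+1}^{(i)} f_l + g_l^{(i)} f_{l+1}, and f_l'' f_l − (f_l')² = (1/4) g_l^{(1)} g_l^{(2)}, where a prime denotes d/dT. -/
/-- The exponential factor `c * exp (T / p + ξ)` has logarithmic derivative `1 / p`. -/
theorem hasDerivAt_const_mul_exp_div_add (c p ξ T : ℝ) :
    HasDerivAt (fun T => c * Real.exp (T / p + ξ)) (c * Real.exp (T / p + ξ) / p) T := by
  refine (((((hasDerivAt_id T).div_const p).add_const ξ).exp).const_mul c).congr_deriv ?_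
  simp only [id_eq]
  ring

/-- the one-soliton tau functions satisfy the semi-discrete bilinear
    form of the 2-component short pulse equation. -/
theorem semidiscrete_twoComponent_SP_one_soliton (a p₁ p₂ : ℝ)
    (ha : a ≠ 0) (hp₁ : p₁ ≠ 0) (hp₂ : p₂ ≠ 0) (hp : p₁ + p₂ ≠ 0)
    (h₁m : 1 - a * p₁ ≠ 0) (h₂m : 1 - a * p₂ ≠ 0)
    (h₁p : 1 + a * p₁ ≠ 0) (h₂p : 1 + a * p₂ ≠ 0)
    (a₁ a₂ ξ₁ ξ₂ : ℝ)
    (b₁₂ : ℝ) (hb : b₁₂ = (p₁ * p₂ / (p₁ + p₂))^2)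
    (ψ₁ ψ₂ : ℤ → ℝ → ℝ)
    (hψ₁ : ∀ (l : ℤ) (T : ℝ),
      ψ₁ l T = ((1 + a * p₁) / (1 - a * p₁)) ^ l * Real.exp (T / p₁ + ξ₁))
    (hψ₂ : ∀ (l : ℤ) (T : ℝ),
      ψ₂ l T = ((1 + a * p₂) / (1 - a * p₂)) ^ l * Real.exp (T / p₂ + ξ₂))
    (f g₁ g₂ : ℤ → ℝ → ℝ)
    (hf : ∀ (l : ℤ) (T : ℝ), f l T = -1 - a₁ * a₂ * b₁₂ / 4 * ψ₁ l T * ψ₂ l T)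
    (hg₁ : ∀ (l : ℤ) (T : ℝ), g₁ l T = -a₁ * ψ₁ l T)
    (hg₂ : ∀ (l : ℤ) (T : ℝ), g₂ l T = -a₂ * ψ₂ l T) :
    (∀ (l : ℤ) (T : ℝ),
      (1/a) * (deriv (g₁ (l+1)) T * f l T - g₁ (l+1) T * deriv (f l) T
        - deriv (g₁ l) T * f (l+1) T + g₁ l T * deriv (f (l+1)) T)
        = g₁ (l+1) T * f l T + g₁ l T * f (l+1) T) ∧
    (∀ (l : ℤ) (T : ℝ),
      (1/a) * (deriv (g₂ (l+1)) T * f l T - g₂ (l+1) T * deriv (f l) T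
        - deriv (g₂ l) T * f (l+1) T + g₂ l T * deriv (f (l+1)) T)
        = g₂ (l+1) T * f l T + g₂ l T * f (l+1) T) ∧
    (∀ (l : ℤ) (T : ℝ),
      deriv (deriv (f l)) T * f l T - (deriv (f l) T)^2 = (1/4) * (g₁ l T * g₂ l T)) := by
  have hd₁ : ∀ l T, HasDerivAt (ψ₁ l) (ψ₁ l T / p₁) T := fun l T => by
    rw [funext (hψ₁ l)]
    exact hasDerivAt_const_mul_exp_div_add _ _ _ _
  have hd₂ : ∀ l T, HasDerivAt (ψ₂ l) (ψ₂ l T / p₂) T := fun l T => by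
    rw [funext (hψ₂ l)]
    exact hasDerivAt_const_mul_exp_div_add _ _ _ _
  have hs₁ : ∀ l T, ψ₁ (l + 1) T = (1 + a * p₁) / (1 - a * p₁) * ψ₁ l T := fun l T => by
    rw [hψ₁, hψ₁, zpow_add_one₀ (div_ne_zero h₁p h₁m)]
    ring
  have hs₂ : ∀ l T, ψ₂ (l + 1) T = (1 + a * p₂) / (1 - a * p₂) * ψ₂ l T := fun l T => by
    rw [hψ₂, hψ₂, zpow_add_one₀ (div_ne_zero h₂p h₂m)]
    ring
  have hdg₁ : ∀ l T, deriv (g₁ l) T = -a₁ * (ψ₁ l T / p₁) := fun l T => by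
    rw [funext (hg₁ l)]
    exact ((hd₁ l T).const_mul _).deriv
  have hdg₂ : ∀ l T, deriv (g₂ l) T = -a₂ * (ψ₂ l T / p₂) := fun l T => by
    rw [funext (hg₂ l)]
    exact ((hd₂ l T).const_mul _).deriv
  have hdprod : ∀ (c : ℝ) l T, HasDerivAt (fun T => c * ψ₁ l T * ψ₂ l T)
      (c * (1 / p₁ + 1 / p₂) * ψ₁ l T * ψ₂ l T) T := fun c l T => by
    refine (((hd₁ l T).const_mul c).mul (hd₂ l T)).congr_deriv ?_
    ring
  have hdf : ∀ l, deriv (f l) =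
      fun T => -(a₁ * a₂ * b₁₂ / 4) * (1 / p₁ + 1 / p₂) * ψ₁ l T * ψ₂ l T := fun l => by
    funext T
    rw [funext (hf l), ((hdprod _ l T).const_sub (-1)).deriv]
    ring
  have hddf : ∀ l T, deriv (deriv (f l)) T =
      -(a₁ * a₂ * b₁₂ / 4) * (1 / p₁ + 1 / p₂) * (1 / p₁ + 1 / p₂) * ψ₁ l T * ψ₂ l T :=
    fun l T => by rw [hdf, (hdprod _ l T).deriv]
  refine ⟨fun l T => ?_, fun l T => ?_, fun l T => ?_⟩
  · simp only [hdg₁, hdf, hf, hg₁, hs₁, hs₂]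
    field_simp
    ring
  · simp only [hdg₂, hdf, hf, hg₂, hs₁, hs₂]
    field_simp
    ring
  · have hbs : b₁₂ * (1 / p₁ + 1 / p₂) ^ 2 = 1 := by
      rw [hb]
      field_simp
      ring
    rw [hddf, hdf, hf, hg₁, hg₂]
    linear_combination a₁ * a₂ / 4 * ψ₁ l T * ψ₂ l T * hbs
end
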